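/- Let (Z, ρ_0) be an antipodal space, and for each n ≥ 1 let Z_n ⊆ Z be a finite subset which is a (1/n)-net of Z with respect to ρ_0 (every ξ ∈ Z admits ζ ∈ Z_n with ρ_0(ξ,ζ) < 1/n) and such that every point of Z_n has a ρ_0-antipode lying in Z_n; set ρ_n := ρ_0 restricted to Z_n × Z_n, so that (Z_n, ρ_n) is a finite antipodal space. Then (Z_n, ρ_n) AI-converges to (Z, ρ_0), and consequently the pointed Moebius spaces (𝓜(Z_n, ρ_n), ρ_n) converge to (𝓜(Z, ρ_0), ρ_0) in the pointed Gromov–Hausdorff sense. In particular, every maximal Gromov product space is a pointed Gromov–Hausdorff limit of maximal Gromov product (hyperbolic) spaces with finite boundary. -/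

import Mathlib

open Filter Topology Metric
open scoped ENNReal

universe u v

/-- A semi-metric (separating function) on a compact metrizable space: continuous, symmetric,
nonnegative, and vanishing exactly on the diagonal. -/
def IsSemiMetric {Z : Type*} [TopologicalSpace Z] (ρ : Z → Z → ℝ) : Prop :=
  Continuous (Function.uncurry ρ) ∧ (∀ ξ η, ρ ξ η = ρ η ξ) ∧
    (∀ ξ η, 0 ≤ ρ ξ η) ∧ ∀ ξ η, ρ ξ η = 0 ↔ ξ = η

/-- An antipodal function: a semi-metric of diameter at most one such that every point has an
antipode at distance one. -/
def IsAntipodalFn {Z : Type*} [TopologicalSpace Z] (ρ : Z → Z → ℝ) : Prop :=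
  IsSemiMetric ρ ∧ (∀ ξ η, ρ ξ η ≤ 1) ∧ ∀ ξ, ∃ η, ρ ξ η = 1

/-- An `ε`-isometry between semi-metric spaces: distortion less than `ε`, and the image is an
`ε`-net. -/
def IsEpsIsometry {Z₁ : Type*} {Z₂ : Type*} (ρ₁ : Z₁ → Z₁ → ℝ) (ρ₂ : Z₂ → Z₂ → ℝ)
    (ε : ℝ) (f : Z₁ → Z₂) : Prop :=
  (∀ ξ η : Z₁, |ρ₂ (f ξ) (f η) - ρ₁ ξ η| < ε) ∧ ∀ ζ : Z₂, ∃ ξ : Z₁, ρ₂ (f ξ) ζ < ε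

/-- AI-convergence of a sequence of semi-metric spaces `(Z n, ρ n)` to `(W, ρ₀)`: there are
`ε n`-isometries `(Z n, ρ n) → (W, ρ₀)` with `ε n → 0+`. -/
def AIConverges {Z : ℕ → Type u} (ρ : ∀ n, Z n → Z n → ℝ) {W : Type v} (ρ₀ : W → W → ℝ) : Prop :=
  ∃ ε : ℕ → ℝ, (∀ n, 0 < ε n) ∧ Tendsto ε atTop (𝓝 0) ∧
    ∀ n, ∃ f : Z n → W, IsEpsIsometry (ρ n) ρ₀ (ε n) f

/-- Rescaling a semi-metric `ρ₀` by a function `τ`: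
`(scaleFn ρ₀ τ) ξ η = e^{τ ξ/2} e^{τ η/2} ρ₀ ξ η`, i.e. the semi-metric Moebius equivalent to
`ρ₀` with `log` derivative `τ`. -/
noncomputable def scaleFn {Z : Type*} (ρ₀ : Z → Z → ℝ) (τ : Z → ℝ) : Z → Z → ℝ :=
  fun ξ η => Real.exp (τ ξ / 2) * Real.exp (τ η / 2) * ρ₀ ξ η

/-- The Moebius space `𝓜(Z, ρ₀)`: all antipodal functions Moebius equivalent to `ρ₀`,
parametrized by their `log` derivatives `τ ∈ C(Z, ℝ)`; for `Z` compact the sup-metric on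
`C(Z, ℝ)` induces exactly the metric `d_𝓜(ρ₁, ρ₂) = ‖log (dρ₂/dρ₁)‖_∞`. -/
def MoebiusSpace {Z : Type*} [TopologicalSpace Z] (ρ₀ : Z → Z → ℝ) : Type _ :=
  {τ : C(Z, ℝ) // IsAntipodalFn (scaleFn ρ₀ τ)}

noncomputable instance {Z : Type*} [TopologicalSpace Z] [CompactSpace Z] (ρ₀ : Z → Z → ℝ) :
    MetricSpace (MoebiusSpace ρ₀) :=
  inferInstanceAs (MetricSpace {τ : C(Z, ℝ) // IsAntipodalFn (scaleFn ρ₀ τ)})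

/-- The base point `ρ₀ ∈ 𝓜(Z, ρ₀)`, corresponding to `τ = 0`. -/
noncomputable def MoebiusBase {Z : Type*} [TopologicalSpace Z] (ρ₀ : Z → Z → ℝ)
    (h : IsAntipodalFn ρ₀) : MoebiusSpace ρ₀ :=
  ⟨0, by
    have h0 : scaleFn ρ₀ ((0 : C(Z, ℝ)) : Z → ℝ) = ρ₀ := by
      funext ξ η
      simp [scaleFn]
    rw [h0]
    exact h⟩

/-- Pointed Gromov–Hausdorff convergence of pointed metric spaces `(X n, p n) → (Y, q)`:
for every `R > 0` and `ε > 0`, for all sufficiently large `n` there is a map between the closed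
balls of radius `R` around the base points, sending base point to base point, with distortion
less than `ε` and whose image is an `ε`-net. -/
def PointedGHConverges (X : ℕ → Type u) [∀ n, MetricSpace (X n)] (p : ∀ n, X n)
    (Y : Type v) [MetricSpace Y] (q : Y) : Prop :=
  ∀ (R : ℝ) (hR : 0 < R) (ε : ℝ) (_ : 0 < ε), ∃ N : ℕ, ∀ n, N ≤ n →
    ∃ f : Metric.closedBall (p n) R → Metric.closedBall q R,
      ((f ⟨p n, Metric.mem_closedBall_self hR.le⟩ : Y) = q) ∧
      (∀ a b : Metric.closedBall (p n) R,
        |dist (f a : Y) (f b : Y) - dist (a : X n) (b : X n)| < ε) ∧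
      ∀ z : Metric.closedBall q R, ∃ a : Metric.closedBall (p n) R, dist (f a : Y) (z : Y) < ε

/-- A geodesic segment from `x` to `y`, parametrized by arclength on `[0, dist x y]`. -/
def IsGeodesicSegment {X : Type*} [MetricSpace X] (γ : ℝ → X) (x y : X) : Prop :=
  γ 0 = x ∧ γ (dist x y) = y ∧
    ∀ s ∈ Set.Icc (0:ℝ) (dist x y), ∀ t ∈ Set.Icc (0:ℝ) (dist x y), dist (γ s) (γ t) = |s - t|

/-- A geodesic metric space: any two points are joined by a geodesic segment. -/
def IsGeodesicSpace (X : Type*) [MetricSpace X] : Prop :=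
  ∀ x y : X, ∃ γ : ℝ → X, IsGeodesicSegment γ x y

/-- Geodesic completeness: any geodesic segment extends to a bi-infinite geodesic. -/
def IsGeodesicallyComplete (X : Type*) [MetricSpace X] : Prop :=
  ∀ (x y : X) (γ : ℝ → X), IsGeodesicSegment γ x y →
    ∃ γ' : ℝ → X, (∀ s t : ℝ, dist (γ' s) (γ' t) = |s - t|) ∧
      ∀ s ∈ Set.Icc (0:ℝ) (dist x y), γ' s = γ s

/-- The data of a Gromov product space: a proper, geodesic, geodesically complete metric space
`X` together with a second countable Hausdorff compactification on which all the Gromov products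
`(·|·)_x` extend continuously (with values in `[0, ∞]`), the extension being `∞` at a pair of
boundary points iff the two points coincide. -/
structure GromovProductData (X : Type u) [MetricSpace X] : Type (u + 1) where
  geodesic : IsGeodesicSpace X
  geodesicallyComplete : IsGeodesicallyComplete X
  proper : ∀ (x : X) (r : ℝ), IsCompact (Metric.closedBall x r)
  Compactification : Type u
  [topC : TopologicalSpace Compactification]
  compactC : CompactSpace Compactification
  t2C : T2Space Compactification
  secondCountableC : SecondCountableTopology Compactification
  incl : X → Compactification
  isEmbedding_incl : Topology.IsEmbedding incl
  dense_incl : Dense (Set.range incl)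
  Boundary : Type u
  [topB : TopologicalSpace Boundary]
  bIncl : Boundary → Compactification
  isEmbedding_bIncl : Topology.IsEmbedding bIncl
  range_bIncl : Set.range bIncl = (Set.range incl)ᶜ
  gp : X → Compactification → Compactification → ℝ≥0∞
  continuous_gp : ∀ x : X,
    Continuous (fun pq : Compactification × Compactification => gp x pq.1 pq.2)
  gp_eq : ∀ x y z : X,
    gp x (incl y) (incl z) = ENNReal.ofReal ((dist y x + dist z x - dist y z) / 2)
  gp_top_iff : ∀ (x : X) (ξ η : Boundary), gp x (bIncl ξ) (bIncl η) = ⊤ ↔ ξ = η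

attribute [instance] GromovProductData.topC GromovProductData.topB

/-- The visual antipodal function `ρ_x = exp (−(·|·)_x)` on the Gromov product boundary. -/
noncomputable def GromovProductData.visual {X : Type u} [MetricSpace X]
    (D : GromovProductData X) (x : X) : D.Boundary → D.Boundary → ℝ :=
  fun ξ η =>
    if D.gp x (D.bIncl ξ) (D.bIncl η) = ⊤ then 0
    else Real.exp (-(D.gp x (D.bIncl ξ) (D.bIncl η)).toReal)

/-- Maximality of a Gromov product space, via the equivalent characterization: for every `x`,
the visual embedding `y ↦ ρ_y` is an isometry of `X` onto the Moebius space
`𝓜(∂_P X, ρ_x)`, i.e. it is isometric (the distance of `y, z` equals the sup-norm of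
`log (dρ_z/dρ_y)`) and surjective onto the set of antipodal functions Moebius equivalent
to `ρ_x`. -/
def GromovProductData.IsMaximal {X : Type u} [MetricSpace X] (D : GromovProductData X) : Prop :=
  ∀ x : X,
    (∀ y z : X, ∃ τ : D.Boundary → ℝ,
      (∀ ξ η, D.visual z ξ η ^ 2 = Real.exp (τ ξ) * Real.exp (τ η) * D.visual y ξ η ^ 2) ∧
      IsLUB (Set.range fun ξ => |τ ξ|) (dist y z)) ∧
    ∀ β : D.Boundary → D.Boundary → ℝ, IsAntipodalFn β →
      (∃ τ : D.Boundary → ℝ, Continuous τ ∧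
        ∀ ξ η, β ξ η ^ 2 = Real.exp (τ ξ) * Real.exp (τ η) * D.visual x ξ η ^ 2) →
      ∃ y : X, D.visual y = β

/-- `c` is the conjugate of `a` with respect to the kernel `κ`:
`c ξ = min_w (-a w - 2 log κ ξ w)` for every `ξ`. -/
structure IsKernelConj {Z W : Type*} (κ : Z → W → ℝ) (a : W → ℝ) (c : Z → ℝ) : Prop where
  le_exp : ∀ ξ w, κ ξ w ≤ Real.exp (-(c ξ + a w) / 2)
  exists_eq : ∀ ξ, ∃ w, κ ξ w = Real.exp (-(c ξ + a w) / 2)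

lemma IsKernelConj.le_of_forall {Z W : Type*} {κ : Z → W → ℝ} {a : W → ℝ} {c : Z → ℝ}
    (h : IsKernelConj κ a c) {ξ : Z} {x : ℝ} (hx : ∀ w, κ ξ w ≤ Real.exp (-(x + a w) / 2)) :
    x ≤ c ξ := by
  obtain ⟨w, hw⟩ := h.exists_eq ξ
  have := hx w
  rw [hw, Real.exp_le_exp] at this
  linarith

lemma IsKernelConj.le_add {Z W : Type*} {κ : Z → W → ℝ} {a b : W → ℝ} {c d : Z → ℝ}
    (h : IsKernelConj κ a c) (h' : IsKernelConj κ b d) {r : ℝ} (hab : ∀ w, a w ≤ b w + r) (ξ : Z) :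
    d ξ ≤ c ξ + r := by
  rw [← sub_le_iff_le_add]
  refine h.le_of_forall fun w => (h'.le_exp ξ w).trans ?_
  rw [Real.exp_le_exp]
  linarith [hab w]

lemma exists_isKernelConj {Z W : Type*} [TopologicalSpace Z] [TopologicalSpace W] [CompactSpace W]
    {κ : Z → W → ℝ} (hκ : Continuous (Function.uncurry κ)) (hpos : ∀ ξ, ∃ w, 0 < κ ξ w)
    (a : C(W, ℝ)) : ∃ c : C(Z, ℝ), IsKernelConj κ a c := by
  set g : Z → W → ℝ := fun ξ w => κ ξ w * Real.exp (a w / 2) with hg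
  have hgc : Continuous (Function.uncurry g) := by
    change Continuous fun p : Z × W => κ p.1 p.2 * Real.exp (a p.2 / 2)
    have h1 : Continuous fun p : Z × W => κ p.1 p.2 := hκ
    fun_prop
  set m : Z → ℝ := fun ξ => sSup (g ξ '' Set.univ) with hm
  have hmc : Continuous m := isCompact_univ.continuous_sSup hgc
  have hgξ : ∀ ξ, Continuous (g ξ) := fun ξ => hgc.comp (by fun_prop : Continuous fun w => (ξ, w))
  have hle : ∀ ξ w, g ξ w ≤ m ξ := fun ξ w =>
    le_csSup (isCompact_univ.image (hgξ ξ)).bddAbove ⟨w, trivial, rfl⟩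
  have hex : ∀ ξ, ∃ w, m ξ = g ξ w := fun ξ => by
    obtain ⟨w, -, hw⟩ := isCompact_univ.exists_sSup_image_eq
      (⟨(hpos ξ).choose, trivial⟩ : (Set.univ : Set W).Nonempty) (hgξ ξ).continuousOn
    exact ⟨w, hw⟩
  have hmpos : ∀ ξ, 0 < m ξ := fun ξ => by
    obtain ⟨w, hw⟩ := hpos ξ
    exact (mul_pos hw (Real.exp_pos _)).trans_le (hle ξ w)
  have hexp : ∀ ξ w, Real.exp (-(-2 * Real.log (m ξ) + a w) / 2) = m ξ * Real.exp (-(a w / 2)) := by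
    intro ξ w
    rw [show -(-2 * Real.log (m ξ) + a w) / 2 = Real.log (m ξ) + -(a w / 2) by ring,
      Real.exp_add, Real.exp_log (hmpos ξ)]
  have hκg : ∀ ξ w, κ ξ w = g ξ w * Real.exp (-(a w / 2)) := by
    intro ξ w
    rw [hg, mul_assoc, ← Real.exp_add, add_neg_cancel, Real.exp_zero, mul_one]
  refine ⟨⟨fun ξ => -2 * Real.log (m ξ), ?_⟩, ⟨fun ξ w => ?_, fun ξ => ?_⟩⟩
  · exact continuous_const.mul (hmc.log fun ξ => (hmpos ξ).ne')
  · rw [ContinuousMap.coe_mk, hexp, hκg]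
    exact mul_le_mul_of_nonneg_right (hle ξ w) (Real.exp_pos _).le
  · obtain ⟨w, hw⟩ := hex ξ
    exact ⟨w, by rw [ContinuousMap.coe_mk, hexp, hκg, hw]⟩

/-- Admissible rescalings: those for which `scaleFn ρ τ ≤ 1`. -/
def IsAdmissible {Z : Type*} (ρ : Z → Z → ℝ) (τ : Z → ℝ) : Prop :=
  ∀ ξ η, ρ ξ η ≤ Real.exp (-(τ ξ + τ η) / 2)

lemma IsKernelConj.isAdmissible {Z : Type*} {ρ : Z → Z → ℝ} {τ : Z → ℝ} (h : IsKernelConj ρ τ τ) :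
    IsAdmissible ρ τ := h.le_exp

lemma IsAdmissible.le_conj {Z : Type*} {ρ : Z → Z → ℝ} {τ c : Z → ℝ} (h : IsAdmissible ρ τ)
    (hc : IsKernelConj ρ τ c) (ξ : Z) : τ ξ ≤ c ξ :=
  hc.le_of_forall fun η => h ξ η

/-- Weighted means of two upper bounds for `-2 log ρ` are again such bounds. -/
lemma le_exp_convex {r s s' a b : ℝ} (h : r ≤ Real.exp (-s / 2)) (h' : r ≤ Real.exp (-s' / 2))
    (ha : 0 ≤ a) (hb : 0 ≤ b) (hab : a + b = 1) : r ≤ Real.exp (-(a * s + b * s') / 2) := by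
  obtain rfl : b = 1 - a := by linarith
  rcases le_total s s' with hs | hs
  · refine h'.trans (Real.exp_le_exp.2 ?_)
    nlinarith [mul_le_mul_of_nonneg_left hs ha]
  · refine h.trans (Real.exp_le_exp.2 ?_)
    nlinarith [mul_le_mul_of_nonneg_left hs hb]

lemma IsAdmissible.convex {Z : Type*} {ρ : Z → Z → ℝ} {τ σ υ : Z → ℝ} (h : IsAdmissible ρ τ)
    (h' : IsAdmissible ρ σ) {a b : ℝ} (ha : 0 ≤ a) (hb : 0 ≤ b) (hab : a + b = 1)
    (hυ : ∀ ξ, υ ξ = a * τ ξ + b * σ ξ) : IsAdmissible ρ υ := by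
  intro ξ η
  convert le_exp_convex (h ξ η) (h' ξ η) ha hb hab using 2
  rw [hυ, hυ]
  ring

lemma scaleFn_eq {Z : Type*} (ρ : Z → Z → ℝ) (τ : Z → ℝ) (ξ η : Z) :
    scaleFn ρ τ ξ η = ρ ξ η / Real.exp (-(τ ξ + τ η) / 2) := by
  rw [scaleFn, ← Real.exp_add, div_eq_mul_inv _ (Real.exp _), ← Real.exp_neg, mul_comm]
  congr 2
  ring

lemma scaleFn_le_one_iff {Z : Type*} (ρ : Z → Z → ℝ) (τ : Z → ℝ) (ξ η : Z) :
    scaleFn ρ τ ξ η ≤ 1 ↔ ρ ξ η ≤ Real.exp (-(τ ξ + τ η) / 2) := by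
  rw [scaleFn_eq, div_le_one (Real.exp_pos _)]

lemma scaleFn_eq_one_iff {Z : Type*} (ρ : Z → Z → ℝ) (τ : Z → ℝ) (ξ η : Z) :
    scaleFn ρ τ ξ η = 1 ↔ ρ ξ η = Real.exp (-(τ ξ + τ η) / 2) := by
  rw [scaleFn_eq, div_eq_one_iff_eq (Real.exp_pos _).ne']

lemma isAntipodalFn_scaleFn_iff {Z : Type*} [TopologicalSpace Z] {ρ : Z → Z → ℝ}
    (hρ : IsAntipodalFn ρ) (τ : C(Z, ℝ)) : IsAntipodalFn (scaleFn ρ τ) ↔ IsKernelConj ρ τ τ := by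
  constructor
  · rintro ⟨-, h1, h2⟩
    exact ⟨fun ξ η => (scaleFn_le_one_iff ρ τ ξ η).1 (h1 ξ η),
      fun ξ => (h2 ξ).imp fun η => (scaleFn_eq_one_iff ρ τ ξ η).1⟩
  · rintro ⟨h1, h2⟩
    obtain ⟨⟨hc, hs, h0, hz⟩, -, -⟩ := hρ
    refine ⟨⟨?_, fun ξ η => ?_, fun ξ η => ?_, fun ξ η => ?_⟩,
      fun ξ η => (scaleFn_le_one_iff ρ τ ξ η).2 (h1 ξ η),
      fun ξ => (h2 ξ).imp fun η => (scaleFn_eq_one_iff ρ τ ξ η).2⟩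
    · have h3 : Continuous fun p : Z × Z => ρ p.1 p.2 := hc
      change Continuous fun p : Z × Z =>
        Real.exp (τ p.1 / 2) * Real.exp (τ p.2 / 2) * ρ p.1 p.2
      fun_prop
    · rw [scaleFn, scaleFn, hs ξ η, mul_comm (Real.exp (τ ξ / 2))]
    · exact mul_nonneg (by positivity) (h0 ξ η)
    · rw [← hz ξ η, scaleFn]
      simp

lemma IsAntipodalFn.exists_pos {Z : Type*} [TopologicalSpace Z] {ρ : Z → Z → ℝ}
    (hρ : IsAntipodalFn ρ) (ξ : Z) : ∃ η, 0 < ρ ξ η :=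
  (hρ.2.2 ξ).imp fun η h => by rw [h]; exact one_pos

lemma IsAntipodalFn.symm {Z : Type*} [TopologicalSpace Z] {ρ : Z → Z → ℝ}
    (hρ : IsAntipodalFn ρ) (ξ η : Z) : ρ ξ η = ρ η ξ := hρ.1.2.1 ξ η

lemma IsAntipodalFn.isKernelConj_zero {Z : Type*} [TopologicalSpace Z] {ρ : Z → Z → ℝ}
    (hρ : IsAntipodalFn ρ) : IsKernelConj ρ (0 : C(Z, ℝ)) (0 : C(Z, ℝ)) :=
  ⟨fun ξ η => by simpa using hρ.2.1 ξ η, fun ξ => by simpa using hρ.2.2 ξ⟩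

lemma IsKernelConj.dist_le_dist {Z W : Type*} [TopologicalSpace Z] [TopologicalSpace W] [CompactSpace Z]
    [CompactSpace W] {κ : Z → W → ℝ} {a b : C(W, ℝ)} {c d : C(Z, ℝ)}
    (h : IsKernelConj κ a c) (h' : IsKernelConj κ b d) : dist c d ≤ dist a b := by
  rw [ContinuousMap.dist_le dist_nonneg]
  intro ξ
  have key : ∀ w, |a w - b w| ≤ dist a b := fun w =>
    ContinuousMap.dist_apply_le_dist (f := a) (g := b) w
  rw [Real.dist_eq, abs_sub_le_iff]
  constructor
  · linarith [h'.le_add h (r := dist a b) (fun w => by linarith [(abs_le.1 (key w)).1]) ξ]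
  · linarith [h.le_add h' (r := dist a b) (fun w => by linarith [(abs_le.1 (key w)).2]) ξ]

/-- The canonical nonexpansive retraction of admissible rescalings onto the Moebius space. -/
lemma exists_retraction {Z : Type*} [TopologicalSpace Z] [CompactSpace Z] {ρ : Z → Z → ℝ}
    (hρ : IsAntipodalFn ρ) : ∃ p : C(Z, ℝ) → C(Z, ℝ),
      (∀ τ : C(Z, ℝ), IsAdmissible ρ τ → IsKernelConj ρ (p τ) (p τ) ∧ ∀ ξ, τ ξ ≤ p τ ξ) ∧
      (∀ τ σ : C(Z, ℝ), IsAdmissible ρ τ → IsAdmissible ρ σ → dist (p τ) (p σ) ≤ dist τ σ) ∧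
      ∀ τ : C(Z, ℝ), IsKernelConj ρ τ τ → p τ = τ := by
  choose cj hcj using exists_isKernelConj hρ.1.1 hρ.exists_pos
  set q : C(Z, ℝ) → C(Z, ℝ) := fun τ => (1 / 2 : ℝ) • (τ + cj τ) with hq
  have hqa : ∀ τ ξ, q τ ξ = 1 / 2 * τ ξ + 1 / 2 * cj τ ξ := fun τ ξ => by
    simp [hq]
  have hcj_eq : ∀ τ : C(Z, ℝ), IsKernelConj ρ τ τ → cj τ = τ := by
    intro τ h
    ext ξ
    exact le_antisymm (h.le_of_forall (hcj τ |>.le_exp ξ)) ((hcj τ).le_of_forall (h.le_exp ξ))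
  have hcj_lip : ∀ τ σ, dist (cj τ) (cj σ) ≤ dist τ σ := fun τ σ =>
    (hcj τ).dist_le_dist (hcj σ)
  have hq_lip : ∀ τ σ, dist (q τ) (q σ) ≤ dist τ σ := by
    intro τ σ
    rw [ContinuousMap.dist_le dist_nonneg]
    intro ξ
    have h1 := ContinuousMap.dist_apply_le_dist (f := τ) (g := σ) ξ
    have h2 := (ContinuousMap.dist_apply_le_dist (f := cj τ) (g := cj σ) ξ).trans (hcj_lip τ σ)
    rw [Real.dist_eq, abs_le] at *
    rw [hqa, hqa]
    constructor <;> linarith [h1.1, h1.2, h2.1, h2.2]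
  have hq_fix : ∀ τ : C(Z, ℝ), IsKernelConj ρ τ τ → q τ = τ := by
    intro τ h
    ext ξ
    rw [hqa, hcj_eq τ h]
    ring
  have hq_adm : ∀ τ : C(Z, ℝ), IsAdmissible ρ τ → IsAdmissible ρ (q τ) := by
    intro τ h ξ η
    have h1 := (hcj τ).le_exp ξ η
    have h2 := (hcj τ).le_exp η ξ
    rw [hρ.symm η ξ] at h2
    convert le_exp_convex h1 h2 (a := 1 / 2) (b := 1 / 2) (by norm_num) (by norm_num)
      (by norm_num) using 2
    rw [hqa, hqa]
    ring
  have hq_le : ∀ τ : C(Z, ℝ), IsAdmissible ρ τ → ∀ ξ, τ ξ ≤ q τ ξ := by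
    intro τ h ξ
    rw [hqa]
    linarith [h.le_conj (hcj τ) ξ]
  have hq_le_cj : ∀ τ : C(Z, ℝ), IsAdmissible ρ τ → ∀ ξ, cj (q τ) ξ ≤ cj τ ξ := by
    intro τ h ξ
    have := (hcj τ).le_add (hcj (q τ)) (r := 0) (fun η => by linarith [hq_le τ h η]) ξ
    linarith
  have hit_adm : ∀ τ : C(Z, ℝ), IsAdmissible ρ τ → ∀ n, IsAdmissible ρ (q^[n] τ) := by
    intro τ h n
    induction n with
    | zero => exact h
    | succ n ih => rw [Function.iterate_succ_apply']; exact hq_adm _ ih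
  have hgap : ∀ τ : C(Z, ℝ), IsAdmissible ρ τ → ∀ n ξ,
      cj (q^[n] τ) ξ - (q^[n] τ) ξ ≤ dist τ (cj τ) / 2 ^ n := by
    intro τ h n
    induction n with
    | zero =>
      intro ξ
      have h1 := ContinuousMap.dist_apply_le_dist (f := τ) (g := cj τ) ξ
      rw [Real.dist_eq, abs_le] at h1
      simp only [Function.iterate_zero, id, pow_zero, div_one]
      linarith [h1.1]
    | succ n ih =>
      intro ξ
      have h1 := ih ξ
      have h2 := hq_le_cj _ (hit_adm τ h n) ξ
      rw [Function.iterate_succ_apply', pow_succ, ← div_div, hqa (q^[n] τ)]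
      linarith
  have hstep : ∀ τ : C(Z, ℝ), IsAdmissible ρ τ → ∀ n,
      dist (q^[n] τ) (q^[n + 1] τ) ≤ dist τ (cj τ) / 2 / 2 ^ n := by
    intro τ h n
    rw [ContinuousMap.dist_le (by positivity)]
    intro ξ
    rw [Function.iterate_succ_apply', Real.dist_eq, abs_le, hqa]
    have h1 := hgap τ h n ξ
    have h2 := (hit_adm τ h n).le_conj (hcj _) ξ
    have h3 : dist τ (cj τ) / 2 / 2 ^ n = (dist τ (cj τ) / 2 ^ n) / 2 := by ring
    rw [h3]
    constructor <;> linarith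
  set p : C(Z, ℝ) → C(Z, ℝ) := fun τ => limUnder atTop fun n => q^[n] τ
  have hlim : ∀ τ : C(Z, ℝ), IsAdmissible ρ τ → Tendsto (fun n => q^[n] τ) atTop (𝓝 (p τ)) :=
    fun τ h => (cauchySeq_of_le_geometric_two (hstep τ h)).tendsto_limUnder
  have hle_lim : ∀ τ : C(Z, ℝ), IsAdmissible ρ τ → ∀ ξ, τ ξ ≤ p τ ξ := by
    intro τ h ξ
    have hmono : Monotone fun n => (q^[n] τ) ξ := monotone_nat_of_le_succ fun n => by
      rw [Function.iterate_succ_apply']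
      exact hq_le _ (hit_adm τ h n) ξ
    exact hmono.ge_of_tendsto (((continuous_eval_const ξ).tendsto _).comp
      (hlim τ h)) 0
  have hcj_cont : Continuous cj :=
    (LipschitzWith.of_dist_le_mul (K := 1) fun τ σ => by simpa using hcj_lip τ σ).continuous
  have hfix : ∀ τ : C(Z, ℝ), IsAdmissible ρ τ → cj (p τ) = p τ := by
    intro τ h
    ext ξ
    have h1 : Tendsto (fun n => cj (q^[n] τ) ξ - (q^[n] τ) ξ) atTop
        (𝓝 (cj (p τ) ξ - p τ ξ)) :=
      ((((continuous_eval_const ξ).comp hcj_cont).tendsto _).comp (hlim τ h)).sub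
        (((continuous_eval_const ξ).tendsto _).comp (hlim τ h))
    have h2 : Tendsto (fun n : ℕ => dist τ (cj τ) / 2 ^ n) atTop (𝓝 0) := by
      simpa [div_eq_mul_inv] using
        (tendsto_pow_atTop_nhds_zero_of_lt_one (r := (2⁻¹ : ℝ)) (by norm_num)
          (by norm_num)).const_mul (dist τ (cj τ))
    have h3 := squeeze_zero (fun n => sub_nonneg.2 ((hit_adm τ h n).le_conj (hcj _) ξ))
      (fun n => hgap τ h n ξ) h2
    exact sub_eq_zero.1 (tendsto_nhds_unique h1 h3)
  refine ⟨p, fun τ h => ⟨?_, hle_lim τ h⟩, fun τ σ hτ hσ => ?_, fun τ h => ?_⟩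
  · have := hcj (p τ)
    rwa [hfix τ h] at this
  · refine le_of_tendsto ((hlim τ hτ).dist (hlim σ hσ)) (Eventually.of_forall fun n => ?_)
    induction n with
    | zero => exact le_rfl
    | succ n ih =>
      rw [Function.iterate_succ_apply', Function.iterate_succ_apply']
      exact (hq_lip _ _).trans ih
  · have : (fun n => q^[n] τ) = fun _ => τ :=
      funext fun n => Function.iterate_fixed (hq_fix τ h) n
    change limUnder atTop (fun n => q^[n] τ) = τ
    rw [this]
    exact tendsto_const_nhds.limUnder_eq

lemma exp_sub_le_of_le_add {r s t R e : ℝ} (hs : s ≤ 2 * R) (he : 0 ≤ e)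
    (h : Real.exp (-s / 2) ≤ r + Real.exp (-R) * (1 - Real.exp (-e / 2)))
    (hr : r ≤ Real.exp (-t / 2)) : t ≤ s + e := by
  have h1 : Real.exp (-R) ≤ Real.exp (-s / 2) := Real.exp_le_exp.2 (by linarith)
  have h2 : Real.exp (-e / 2) ≤ 1 := Real.exp_le_one_iff.2 (by linarith)
  have h3 : Real.exp (-(s + e) / 2) = Real.exp (-s / 2) * Real.exp (-e / 2) := by
    rw [← Real.exp_add]; congr 1; ring
  have h4 : Real.exp (-(s + e) / 2) ≤ Real.exp (-t / 2) := by
    nlinarith [mul_le_mul_of_nonneg_right h1 (sub_nonneg.2 h2)]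
  rw [Real.exp_le_exp] at h4
  linarith

lemma le_exp_of_le_add {r s R e : ℝ} (hs : s ≤ 2 * R) (he : 0 ≤ e)
    (h : r ≤ Real.exp (-s / 2) + Real.exp (-R) * (1 - Real.exp (-e / 2))) :
    r ≤ Real.exp (-(s - e) / 2) := by
  have h1 : Real.exp (-R) ≤ Real.exp (-s / 2) := Real.exp_le_exp.2 (by linarith)
  have h2 : Real.exp (-e / 2) ≤ 1 := Real.exp_le_one_iff.2 (by linarith)
  have h3 : Real.exp (-(s - e) / 2) = Real.exp (-s / 2) * Real.exp (e / 2) := by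
    rw [← Real.exp_add]; congr 1; ring
  have h4 : 1 - Real.exp (-e / 2) ≤ Real.exp (e / 2) - 1 := by
    have := Real.add_one_le_exp (e / 2)
    have := Real.add_one_le_exp (-e / 2)
    linarith
  nlinarith [mul_le_mul_of_nonneg_right h1 (sub_nonneg.2 h2),
    mul_le_mul_of_nonneg_left h4 (Real.exp_pos (-s / 2)).le]

/-- Conjugates are equicontinuous on bounded sets. -/
lemma IsKernelConj.le_add_of_close {Z W : Type*} {κ : Z → W → ℝ} {a : W → ℝ} {c : Z → ℝ}
    (h : IsKernelConj κ a c) {R e : ℝ} (he : 0 ≤ e) (ha : ∀ w, a w ≤ R) {ξ ξ' : Z} (hc : c ξ' ≤ R)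
    (hclose : ∀ w, κ ξ' w ≤ κ ξ w + Real.exp (-R) * (1 - Real.exp (-e / 2))) :
    c ξ ≤ c ξ' + e := by
  obtain ⟨w, hw⟩ := h.exists_eq ξ'
  have h1 := hclose w
  rw [hw] at h1
  have := exp_sub_le_of_le_add (by linarith [ha w]) he h1 (h.le_exp ξ w)
  linarith

/-- Points which are `ρ`-close have uniformly close `ρ`-distances to all other points. -/
lemma IsSemiMetric.exists_forall_abs_sub_lt {Z : Type*} [TopologicalSpace Z] [CompactSpace Z]
    {ρ : Z → Z → ℝ} (hρ : IsSemiMetric ρ) {δ : ℝ} (hδ : 0 < δ) :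
    ∃ ε > 0, ∀ ξ ξ', ρ ξ ξ' < ε → ∀ η, |ρ ξ η - ρ ξ' η| < δ := by
  obtain ⟨hc, -, h0, hz⟩ := hρ
  have hc' : Continuous fun p : Z × Z => ρ p.1 p.2 := hc
  set K : Set (Z × Z × Z) := {p | δ ≤ |ρ p.1 p.2.2 - ρ p.2.1 p.2.2|}
  have hK : IsCompact K := by
    refine (isClosed_le continuous_const ?_).isCompact
    have h1 : Continuous fun p : Z × Z × Z => ρ p.1 p.2.2 :=
      hc'.comp (continuous_fst.prodMk (continuous_snd.comp continuous_snd))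
    have h2 : Continuous fun p : Z × Z × Z => ρ p.2.1 p.2.2 := hc'.comp continuous_snd
    exact (h1.sub h2).abs
  have hf : Continuous fun p : Z × Z × Z => ρ p.1 p.2.1 :=
    hc'.comp (continuous_fst.prodMk (continuous_fst.comp continuous_snd))
  rcases K.eq_empty_or_nonempty with hE | hE
  · refine ⟨1, one_pos, fun ξ ξ' _ η => ?_⟩
    by_contra! hcon
    have : (ξ, ξ', η) ∈ K := hcon
    simp [hE] at this
  · obtain ⟨p, hp, hmin⟩ := hK.exists_isMinOn hE hf.continuousOn
    refine ⟨ρ p.1 p.2.1, (h0 _ _).lt_of_ne fun h => ?_, fun ξ ξ' h η => ?_⟩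
    · have h1 := (hz _ _).1 h.symm
      have h2 : δ ≤ |ρ p.1 p.2.2 - ρ p.2.1 p.2.2| := hp
      rw [h1, sub_self, abs_zero] at h2
      exact absurd h2 hδ.not_ge
    · by_contra! hcon
      exact absurd (hmin (show (ξ, ξ', η) ∈ K from hcon)) (not_le.2 h)

/-- `S` is so dense in `(Z, ρ)` that logarithmic derivatives bounded by `R` oscillate by at most
`e` between a point of `Z` and a nearby point of `S`. -/
def IsFineNet {Z : Type*} (ρ : Z → Z → ℝ) (S : Set Z) (R e : ℝ) : Prop :=
  ∀ ξ, ∃ ζ : S, ∀ η, |ρ ξ η - ρ ζ η| ≤ Real.exp (-R) * (1 - Real.exp (-e / 2))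

lemma IsFineNet.abs_sub_le {Z : Type*} {ρ : Z → Z → ℝ} {S : Set Z} {R e C : ℝ}
    (hS : IsFineNet ρ S R e) (he : 0 ≤ e) {τ σ : Z → ℝ} (hτ : IsKernelConj ρ τ τ)
    (hσ : IsKernelConj ρ σ σ) (hτR : ∀ ξ, τ ξ ≤ R) (hσR : ∀ ξ, σ ξ ≤ R)
    (h : ∀ ζ : S, |τ ζ - σ ζ| ≤ C) (ξ : Z) : |τ ξ - σ ξ| ≤ C + 2 * e := by
  obtain ⟨ζ, hζ⟩ := hS ξ
  have key : ∀ υ : Z → ℝ, IsKernelConj ρ υ υ → (∀ ξ, υ ξ ≤ R) → υ ξ ≤ υ ζ + e ∧ υ ζ ≤ υ ξ + e :=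
    fun υ hυ hR => ⟨hυ.le_add_of_close he hR (hR ζ) fun η => by linarith [(abs_le.1 (hζ η)).1],
      hυ.le_add_of_close he hR (hR ξ) fun η => by linarith [(abs_le.1 (hζ η)).2]⟩
  have h1 := key τ hτ hτR
  have h2 := key σ hσ hσR
  have h3 := abs_le.1 (h ζ)
  rw [abs_le]
  constructor <;> linarith [h1.1, h1.2, h2.1, h2.2, h3.1, h3.2]

/-- Elements of the Moebius space of `Z` are close, over a fine net `S`, to elements of the Moebius
space of `S`. -/
lemma IsFineNet.exists_restrict {Z : Type*} [TopologicalSpace Z] {ρ : Z → Z → ℝ} {S : Set Z}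
    [CompactSpace S] {R e : ℝ} (hS : IsFineNet ρ S R e) (he : 0 ≤ e) (hR : 0 ≤ R)
    (hρ : IsAntipodalFn ρ)
    (hρS : IsAntipodalFn fun ξ η : S => ρ ξ η) {τ : C(Z, ℝ)} (hτ : IsKernelConj ρ τ τ)
    (hτR : ∀ ξ, |τ ξ| ≤ R) :
    ∃ a : C(S, ℝ), IsKernelConj (fun ξ η : S => ρ ξ η) a a ∧ (∀ ζ, |a ζ| ≤ R) ∧
      ∀ ζ : S, |a ζ - τ ζ| ≤ 2 * e := by
  obtain ⟨p, hp1, hp2, hp3⟩ := exists_retraction hρS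
  set r : C(S, ℝ) := τ.restrict S
  have hr : ∀ ζ : S, r ζ = τ ζ := fun ζ => rfl
  have hradm : IsAdmissible (fun ξ η : S => ρ ξ η) r := fun ξ η => hτ.le_exp ξ η
  have hp0 : p 0 = 0 := hp3 0 hρS.isKernelConj_zero
  obtain ⟨ha, hra⟩ := hp1 r hradm
  refine ⟨p r, ha, fun ζ => ?_, fun ζ => ?_⟩
  · have h1 := ContinuousMap.dist_apply_le_dist (f := p r) (g := p 0) ζ
    have h2 := hp2 r 0 hradm hρS.isKernelConj_zero.isAdmissible
    have h3 : dist r 0 ≤ R := (ContinuousMap.dist_le hR).2 fun ζ => by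
      simpa [Real.dist_eq, hr] using hτR ζ
    rw [hp0, Real.dist_eq, ContinuousMap.zero_apply, sub_zero] at h1
    rw [hp0] at h2
    linarith
  · have h1 := hra ζ
    obtain ⟨η, hη⟩ := hτ.exists_eq ζ
    obtain ⟨η', hη'⟩ := hS η
    have h2 := hτ.le_add_of_close (ξ := η') (ξ' := η) he (fun ξ => (abs_le.1 (hτR ξ)).2)
      (abs_le.1 (hτR η)).2 fun η => by linarith [(abs_le.1 (hη' η)).2]
    have h4 := (abs_le.1 (hη' ζ)).2
    rw [hρ.symm η ζ, hρ.symm η' ζ, hη] at h4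
    have h5 := exp_sub_le_of_le_add (t := p r ζ + p r η')
      (by linarith [(abs_le.1 (hτR ζ)).2, (abs_le.1 (hτR η)).2]) he (sub_le_iff_le_add'.1 h4)
      (ha.le_exp ζ η')
    have h6 := hra η'
    have h7 : -e ≤ τ η' - τ η := by
      have := hτ.le_add_of_close (ξ := η) (ξ' := η') he (fun ξ => (abs_le.1 (hτR ξ)).2)
        (abs_le.1 (hτR η')).2 fun η => by linarith [(abs_le.1 (hη' η)).1]
      linarith
    rw [hr] at h1 h6
    rw [abs_le]
    constructor <;> linarith

/-- Elements of the Moebius space of a fine net `S` are close to restrictions of elements of the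
Moebius space of `Z`. -/
lemma IsFineNet.exists_extend {Z : Type*} [TopologicalSpace Z] [CompactSpace Z] {ρ : Z → Z → ℝ}
    {S : Set Z} [CompactSpace S] {R e : ℝ} (hS : IsFineNet ρ S (R + 1) e) (he : 0 < e)
    (he1 : e ≤ 1) (hR : 0 < R) (hρ : IsAntipodalFn ρ)
    (hρS : IsAntipodalFn fun ξ η : S => ρ ξ η) {a : C(S, ℝ)}
    (ha : IsKernelConj (fun ξ η : S => ρ ξ η) a a) (haR : ∀ ζ, |a ζ| ≤ R) :
    ∃ τ : C(Z, ℝ), IsKernelConj ρ τ τ ∧ (∀ ξ, |τ ξ| ≤ R) ∧ ∀ ζ : S, |τ ζ - a ζ| ≤ 3 * e := by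
  have hc : Continuous fun p : Z × Z => ρ p.1 p.2 := hρ.1.1
  obtain ⟨c, hcj⟩ := exists_isKernelConj (κ := fun (ξ : Z) (η : S) => ρ ξ η)
    (hc.comp (by fun_prop : Continuous fun p : Z × S => (p.1, (p.2 : Z)))) (fun ξ => by
      obtain ⟨ζ, hζ⟩ := hS ξ
      obtain ⟨η, hη⟩ := hρS.2.2 ζ
      refine ⟨η, ?_⟩
      have h1 := (abs_le.1 (hζ η)).1
      have h2 : Real.exp (-(R + 1)) * (1 - Real.exp (-e / 2)) < 1 := by
        have h3 : Real.exp (-(R + 1)) < 1 := Real.exp_lt_one_iff.2 (by linarith)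
        nlinarith [Real.exp_pos (-(R + 1)), Real.exp_pos (-e / 2)]
      linarith) a
  have hca : ∀ ζ : S, c ζ = a ζ := fun ζ =>
    le_antisymm (ha.le_of_forall (hcj.le_exp ζ)) (hcj.le_of_forall (ha.le_exp ζ))
  have hab := fun ζ => abs_le.1 (haR ζ)
  have hclose : ∀ (ξ : Z) (ζ : S),
      (∀ η, |ρ ξ η - ρ ζ η| ≤ Real.exp (-(R + 1)) * (1 - Real.exp (-e / 2))) → c ξ ≤ a ζ + e := by
    intro ξ ζ h
    rw [← hca]
    exact hcj.le_add_of_close (R := R + 1) he.le (fun η => by linarith [(hab η).2])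
      (by rw [hca]; linarith [(hab ζ).2]) fun η => by linarith [(abs_le.1 (h η)).1]
  have hcle : ∀ ξ, c ξ ≤ R + e := fun ξ => by
    obtain ⟨ζ, hζ⟩ := hS ξ
    linarith [hclose ξ ζ hζ, (hab ζ).2]
  have hlec : ∀ ξ, -R ≤ c ξ := fun ξ => hcj.le_of_forall fun η =>
    (hρ.2.1 ξ η).trans (Real.one_le_exp (by linarith [(hab η).2]))
  set v : C(Z, ℝ) := c - ContinuousMap.const Z e
  have hv : ∀ ξ, v ξ = c ξ - e := fun ξ => rfl
  have hvadm : IsAdmissible ρ v := by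
    intro ξ ζ
    obtain ⟨ζ', hζ'⟩ := hS ζ
    have h1 := (abs_le.1 (hζ' ξ)).2
    have h2 := hcj.le_exp ξ ζ'
    have h3 := le_exp_of_le_add (r := ρ ξ ζ) (R := R + 1) (s := c ξ + a ζ')
      (by linarith [hcle ξ, (hab ζ').2]) he.le (by
        rw [hρ.symm ζ ξ, hρ.symm ζ' ξ] at h1
        linarith)
    refine h3.trans (Real.exp_le_exp.2 ?_)
    rw [hv, hv]
    linarith [hclose ζ ζ' hζ']
  obtain ⟨p, hp1, hp2, hp3⟩ := exists_retraction hρ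
  have hp0 : p 0 = 0 := hp3 0 hρ.isKernelConj_zero
  set b : C(Z, ℝ) := p v
  obtain ⟨hb, hvb⟩ := hp1 v hvadm
  have hbc : ∀ ξ, b ξ ≤ c ξ + e := by
    intro ξ
    obtain ⟨η, hη⟩ := hcj.exists_eq ξ
    have h1 := hb.le_exp ξ η
    have h2 := hvb η
    rw [hη, Real.exp_le_exp] at h1
    rw [hv, hca] at h2
    linarith
  have hbR : ∀ ξ, |b ξ| ≤ R + 2 * e := fun ξ => abs_le.2
    ⟨by linarith [hvb ξ, hv ξ, hlec ξ], by linarith [hbc ξ, hcle ξ]⟩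
  have hbn : dist b 0 ≤ R + 2 * e := (ContinuousMap.dist_le (by linarith)).2 fun ξ => by
    simpa [Real.dist_eq] using hbR ξ
  set t : ℝ := R / (R + 2 * e)
  have ht0 : 0 ≤ t := by positivity
  have ht1 : t * (R + 2 * e) = R := div_mul_cancel₀ _ (by positivity)
  have ht2 : t ≤ 1 := (div_le_one (by positivity)).2 (by linarith)
  have htb : IsAdmissible ρ (t • b : C(Z, ℝ)) :=
    hb.isAdmissible.convex hρ.isKernelConj_zero.isAdmissible ht0 (sub_nonneg.2 ht2) (by ring)
      fun ξ => by simp [b]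
  have hd1 : dist (p (t • b)) 0 ≤ R := by
    have h1 := hp2 _ 0 htb hρ.isKernelConj_zero.isAdmissible
    rw [hp0] at h1
    refine h1.trans ?_
    rw [dist_zero_right, norm_smul, Real.norm_of_nonneg ht0, ← dist_zero_right, ← ht1]
    exact mul_le_mul_of_nonneg_left hbn ht0
  have hd2 : dist (p (t • b)) b ≤ 2 * e := by
    have h1 := hp2 _ b htb hb.isAdmissible
    rw [hp3 b hb] at h1
    refine h1.trans ?_
    have h2 : t • b - b = -((1 - t) • b) := by rw [sub_smul, one_smul]; abel
    rw [dist_eq_norm, h2, norm_neg, norm_smul, Real.norm_of_nonneg (sub_nonneg.2 ht2),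
      ← dist_zero_right]
    nlinarith [mul_le_mul_of_nonneg_left hbn (sub_nonneg.2 ht2)]
  refine ⟨p (t • b), (hp1 _ htb).1, fun ξ => ?_, fun ζ => ?_⟩
  · have := ContinuousMap.dist_apply_le_dist (f := p (t • b)) (g := 0) ξ
    rw [Real.dist_eq, ContinuousMap.zero_apply, sub_zero] at this
    exact this.trans hd1
  · have h1 := (ContinuousMap.dist_apply_le_dist (f := p (t • b)) (g := b) (ζ : Z)).trans hd2
    rw [Real.dist_eq, abs_le] at h1
    have h2 := hbc ζ
    have h3 := hvb ζ
    rw [hca] at h2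
    rw [hv, hca] at h3
    rw [abs_le]
    constructor <;> linarith [h1.1, h1.2]

lemma MoebiusSpace.isKernelConj {Z : Type*} [TopologicalSpace Z] {ρ : Z → Z → ℝ}
    (hρ : IsAntipodalFn ρ) (a : MoebiusSpace ρ) : IsKernelConj ρ a.1 a.1 :=
  (isAntipodalFn_scaleFn_iff hρ a.1).1 a.2

lemma MoebiusSpace.dist_eq {Z : Type*} [TopologicalSpace Z] [CompactSpace Z] {ρ : Z → Z → ℝ}
    (a b : MoebiusSpace ρ) : dist a b = dist a.1 b.1 := rfl

lemma MoebiusSpace.dist_le_iff {Z : Type*} [TopologicalSpace Z] [CompactSpace Z] {ρ : Z → Z → ℝ}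
    (a b : MoebiusSpace ρ) {C : ℝ} (hC : 0 ≤ C) : dist a b ≤ C ↔ ∀ ξ, |a.1 ξ - b.1 ξ| ≤ C := by
  rw [MoebiusSpace.dist_eq, ContinuousMap.dist_le hC]
  simp only [Real.dist_eq]

lemma MoebiusSpace.abs_sub_le_dist {Z : Type*} [TopologicalSpace Z] [CompactSpace Z]
    {ρ : Z → Z → ℝ} (a b : MoebiusSpace ρ) (ξ : Z) : |a.1 ξ - b.1 ξ| ≤ dist a b :=
  (a.dist_le_iff b dist_nonneg).1 le_rfl ξ

lemma MoebiusSpace.mem_closedBall_base {Z : Type*} [TopologicalSpace Z] [CompactSpace Z]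
    {ρ : Z → Z → ℝ} (hρ : IsAntipodalFn ρ) (a : MoebiusSpace ρ) {R : ℝ} (hR : 0 ≤ R) :
    a ∈ Metric.closedBall (MoebiusBase ρ hρ) R ↔ ∀ ξ, |a.1 ξ| ≤ R := by
  rw [Metric.mem_closedBall, MoebiusSpace.dist_le_iff _ _ hR]
  simp [MoebiusBase]

theorem pointedGHConverges_moebiusSpace {Z : Type u} [TopologicalSpace Z] [CompactSpace Z]
    {ρ₀ : Z → Z → ℝ} (hρ₀ : IsAntipodalFn ρ₀) {Zn : ℕ → Set Z} [∀ n, CompactSpace (Zn n)]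
    (hnet : ∀ (n : ℕ) (ξ : Z), ∃ ζ ∈ Zn n, ρ₀ ξ ζ < 1 / (n + 1))
    (hρn : ∀ n, IsAntipodalFn (fun ξ η : Zn n => ρ₀ ξ η)) :
    PointedGHConverges (fun n => MoebiusSpace (fun ξ η : Zn n => ρ₀ ξ η))
      (fun n => MoebiusBase _ (hρn n)) (MoebiusSpace ρ₀) (MoebiusBase ρ₀ hρ₀) := by
  intro R hR ε hε
  obtain ⟨e, he, he1, heε⟩ : ∃ e : ℝ, 0 < e ∧ e ≤ 1 ∧ 10 * e < ε :=
    ⟨min 1 (ε / 20), by positivity, min_le_left _ _, by linarith [min_le_right 1 (ε / 20)]⟩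
  have hδ : ∀ r : ℝ, 0 < Real.exp (-r) * (1 - Real.exp (-e / 2)) := fun r =>
    mul_pos (Real.exp_pos _) (sub_pos.2 (Real.exp_lt_one_iff.2 (by linarith)))
  obtain ⟨α, hα, hα'⟩ := hρ₀.1.exists_forall_abs_sub_lt (hδ (R + 1))
  obtain ⟨N, hN⟩ := exists_nat_one_div_lt hα
  refine ⟨N, fun n hn => ?_⟩
  have hfine1 : IsFineNet ρ₀ (Zn n) (R + 1) e := by
    intro ξ
    obtain ⟨ζ, hζ, hζ'⟩ := hnet n ξ
    exact ⟨⟨ζ, hζ⟩, fun η => (hα' ξ ζ ((hζ'.trans_le (Nat.one_div_le_one_div hn)).trans hN) η).le⟩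
  have hfine : IsFineNet ρ₀ (Zn n) R e := fun ξ => (hfine1 ξ).imp fun ζ h η => (h η).trans <|
    mul_le_mul_of_nonneg_right (Real.exp_le_exp.2 (by linarith))
      (sub_nonneg.2 (Real.exp_le_one_iff.2 (by linarith)))
  have hext : ∀ a : Metric.closedBall (MoebiusBase _ (hρn n)) R,
      ∃ b : Metric.closedBall (MoebiusBase ρ₀ hρ₀) R, (a.1 = MoebiusBase _ (hρn n) →
        b.1 = MoebiusBase ρ₀ hρ₀) ∧ ∀ ζ : Zn n, |b.1.1 ζ - a.1.1 ζ| ≤ 3 * e := by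
    rintro ⟨a, ha⟩
    by_cases h0 : a = MoebiusBase _ (hρn n)
    · refine ⟨⟨_, Metric.mem_closedBall_self hR.le⟩, fun _ => rfl, fun ζ => ?_⟩
      subst h0
      simp only [MoebiusBase, ContinuousMap.zero_apply, sub_zero, abs_zero]
      positivity
    · obtain ⟨τ, h1, h2, h3⟩ := hfine1.exists_extend he he1 hR hρ₀ (hρn n)
        (a.isKernelConj (hρn n)) ((a.mem_closedBall_base (hρn n) hR.le).1 ha)
      exact ⟨⟨⟨τ, (isAntipodalFn_scaleFn_iff hρ₀ τ).2 h1⟩,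
        (MoebiusSpace.mem_closedBall_base hρ₀ _ hR.le).2 h2⟩, fun h => absurd h h0, h3⟩
  choose f hf0 hf using hext
  have hd : ∀ (x y : Metric.closedBall (MoebiusBase ρ₀ hρ₀) R) {C : ℝ}, 0 ≤ C →
      (∀ ζ : Zn n, |x.1.1 ζ - y.1.1 ζ| ≤ C) → dist (x : MoebiusSpace ρ₀) y ≤ C + 2 * e := by
    intro x y C hC h
    refine (MoebiusSpace.dist_le_iff _ _ (by positivity)).2 fun ξ => ?_
    exact hfine.abs_sub_le he.le (x.1.isKernelConj hρ₀) (y.1.isKernelConj hρ₀)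
      (fun ξ => (abs_le.1 ((x.1.mem_closedBall_base hρ₀ hR.le).1 x.2 ξ)).2)
      (fun ξ => (abs_le.1 ((y.1.mem_closedBall_base hρ₀ hR.le).1 y.2 ξ)).2) h ξ
  refine ⟨f, hf0 _ rfl, fun a b => ?_, fun z => ?_⟩
  · have h1 : dist (f a : MoebiusSpace ρ₀) (f b) ≤ (dist a.1 b.1 + 6 * e) + 2 * e := by
      refine hd _ _ (by positivity) fun ζ => ?_
      have h2 := abs_le.1 (hf a ζ)
      have h3 := abs_le.1 (hf b ζ)
      have h4 := abs_le.1 (a.1.abs_sub_le_dist b.1 ζ)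
      rw [abs_le]
      constructor <;> linarith [h2.1, h2.2, h3.1, h3.2, h4.1, h4.2]
    have h5 : dist a.1 b.1 ≤ dist (f a : MoebiusSpace ρ₀) (f b) + 6 * e := by
      refine (MoebiusSpace.dist_le_iff _ _ (by positivity)).2 fun ζ => ?_
      have h2 := abs_le.1 (hf a ζ)
      have h3 := abs_le.1 (hf b ζ)
      have h4 := abs_le.1 ((f a).1.abs_sub_le_dist (f b).1 ζ)
      rw [abs_le]
      constructor <;> linarith [h2.1, h2.2, h3.1, h3.2, h4.1, h4.2]
    rw [abs_lt]
    constructor <;> linarith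
  · obtain ⟨a, h1, h2, h3⟩ := hfine.exists_restrict he.le hR.le hρ₀ (hρn n)
      (z.1.isKernelConj hρ₀) ((z.1.mem_closedBall_base hρ₀ hR.le).1 z.2)
    refine ⟨⟨⟨a, (isAntipodalFn_scaleFn_iff (hρn n) a).2 h1⟩,
      (MoebiusSpace.mem_closedBall_base (hρn n) _ hR.le).2 h2⟩, ?_⟩
    refine (hd _ z (C := 5 * e) (by positivity) fun ζ => ?_).trans_lt (by linarith)
    have h4 := abs_le.1 (hf ⟨⟨a, (isAntipodalFn_scaleFn_iff (hρn n) a).2 h1⟩,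
      (MoebiusSpace.mem_closedBall_base (hρn n) _ hR.le).2 h2⟩ ζ)
    have h5 := abs_le.1 (h3 ζ)
    rw [abs_le]
    constructor <;> linarith [h4.1, h4.2, h5.1, h5.2]

/-- The canonical nonexpansive retraction onto the Moebius space, as a map into it. -/
lemma exists_retraction_moebiusSpace {Z : Type*} [TopologicalSpace Z] [CompactSpace Z]
    {ρ : Z → Z → ℝ} (hρ : IsAntipodalFn ρ) : ∃ p : C(Z, ℝ) → MoebiusSpace ρ,
      (∀ τ : C(Z, ℝ), IsAdmissible ρ τ → ∀ ξ, τ ξ ≤ (p τ).1 ξ) ∧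
      (∀ τ σ : C(Z, ℝ), IsAdmissible ρ τ → IsAdmissible ρ σ → dist (p τ) (p σ) ≤ dist τ σ) ∧
      ∀ a : MoebiusSpace ρ, p a.1 = a := by
  classical
  obtain ⟨p, h1, h2, h3⟩ := exists_retraction hρ
  have hq : ∀ τ : C(Z, ℝ), ∃ b : MoebiusSpace ρ, IsAdmissible ρ τ → b.1 = p τ := fun τ => by
    by_cases h : IsAdmissible ρ τ
    · exact ⟨⟨p τ, (isAntipodalFn_scaleFn_iff hρ _).2 (h1 τ h).1⟩, fun _ => rfl⟩
    · exact ⟨MoebiusBase ρ hρ, fun h' => absurd h' h⟩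
  choose q hq using hq
  refine ⟨q, fun τ h => ?_, fun τ σ hτ hσ => ?_, fun a => ?_⟩
  · rw [hq τ h]
    exact (h1 τ h).2
  · rw [MoebiusSpace.dist_eq, hq τ hτ, hq σ hσ]
    exact h2 τ σ hτ hσ
  · exact Subtype.ext ((hq _ (a.isKernelConj hρ).isAdmissible).trans (h3 _ (a.isKernelConj hρ)))

lemma MoebiusSpace.exists_sub_eq_dist {Z : Type*} [TopologicalSpace Z] [CompactSpace Z]
    [Nonempty Z] {ρ : Z → Z → ℝ} (hρ : IsAntipodalFn ρ) (a b : MoebiusSpace ρ) :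
    ∃ ξ, b.1 ξ - a.1 ξ = dist a b := by
  obtain ⟨ξ, -, hξ⟩ := isCompact_univ.exists_isMaxOn Set.univ_nonempty
    (f := fun ξ => |b.1 ξ - a.1 ξ|) (by fun_prop)
  have h1 : dist a b ≤ |b.1 ξ - a.1 ξ| := (a.dist_le_iff b (abs_nonneg _)).2 fun η => by
    rw [abs_sub_comm]
    exact hξ (Set.mem_univ η)
  have h2 : ∀ η, b.1 η - a.1 η ≤ dist a b := fun η => by
    linarith [(abs_le.1 (a.abs_sub_le_dist b η)).1]
  rcases abs_cases (b.1 ξ - a.1 ξ) with h | h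
  · exact ⟨ξ, le_antisymm (h2 ξ) (by linarith)⟩
  · obtain ⟨η, hη⟩ := (b.isKernelConj hρ).exists_eq ξ
    refine ⟨η, le_antisymm (h2 η) ?_⟩
    have h3 := (a.isKernelConj hρ).le_exp ξ η
    rw [hη, Real.exp_le_exp] at h3
    linarith

theorem isGeodesicSpace_moebiusSpace {Z : Type*} [TopologicalSpace Z] [CompactSpace Z]
    {ρ : Z → Z → ℝ} (hρ : IsAntipodalFn ρ) : IsGeodesicSpace (MoebiusSpace ρ) := by
  intro a b
  obtain ⟨p, hp1, hp2, hp3⟩ := exists_retraction_moebiusSpace hρ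
  rcases eq_or_ne a b with rfl | hab
  · refine ⟨fun _ => a, rfl, rfl, fun s hs t ht => ?_⟩
    rw [dist_self, Set.Icc_self, Set.mem_singleton_iff] at hs ht
    simp [hs, ht]
  have hd : 0 < dist a b := dist_pos.2 hab
  set d := dist a b with hd_def
  set l : ℝ → C(Z, ℝ) := fun s => (1 - s / d) • a.1 + (s / d) • b.1
  have hl : ∀ s ∈ Set.Icc 0 d, IsAdmissible ρ (l s) := fun s hs =>
    (a.isKernelConj hρ).isAdmissible.convex (b.isKernelConj hρ).isAdmissible
      (sub_nonneg.2 ((div_le_one hd).2 hs.2)) (div_nonneg hs.1 hd.le) (by ring)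
      fun ξ => by simp [l]
  have hl0 : l 0 = a.1 := by simp [l]
  have hld : l d = b.1 := by simp [l, hd.ne']
  have hle : ∀ s ∈ Set.Icc 0 d, ∀ t ∈ Set.Icc 0 d, dist (p (l s)) (p (l t)) ≤ |s - t| := by
    intro s hs t ht
    refine (hp2 _ _ (hl s hs) (hl t ht)).trans ?_
    have h1 : l s - l t = ((t - s) / d) • (a.1 - b.1) := by
      ext ξ
      simp [l]
      ring
    rw [dist_eq_norm, h1, norm_smul, ← dist_eq_norm, ← MoebiusSpace.dist_eq, ← hd_def, norm_div,
      Real.norm_of_nonneg hd.le, div_mul_cancel₀ _ hd.ne', Real.norm_eq_abs, abs_sub_comm]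
  have h0 : (0 : ℝ) ∈ Set.Icc 0 d := ⟨le_rfl, hd.le⟩
  have hdd : d ∈ Set.Icc 0 d := ⟨hd.le, le_rfl⟩
  have heq : ∀ s ∈ Set.Icc 0 d, ∀ t ∈ Set.Icc 0 d, s ≤ t →
      dist (p (l s)) (p (l t)) = |s - t| := by
    intro s hs t ht hst
    refine le_antisymm (hle s hs t ht) ?_
    have h1 := dist_triangle4 (p (l 0)) (p (l s)) (p (l t)) (p (l d))
    have h2 := hle 0 h0 s hs
    have h3 := hle t ht d hdd
    rw [hl0, hld, hp3, hp3, ← hd_def] at h1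
    rw [hl0, hp3, zero_sub, abs_neg, abs_of_nonneg hs.1] at h2
    rw [hld, hp3, abs_of_nonpos (by linarith [ht.2])] at h3
    rw [abs_of_nonpos (by linarith)]
    linarith
  refine ⟨fun s => p (l s), ?_, ?_, fun s hs t ht => ?_⟩
  · change p (l 0) = a
    rw [hl0, hp3]
  · change p (l d) = b
    rw [hld, hp3]
  · rcases le_total s t with h | h
    · exact heq s hs t ht h
    · rw [dist_comm, abs_sub_comm]
      exact heq t ht s hs h

lemma MoebiusSpace.exists_ray {Z : Type*} [TopologicalSpace Z] [CompactSpace Z]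
    [DiscreteTopology Z] {ρ : Z → Z → ℝ} (hρ : IsAntipodalFn ρ) (a : MoebiusSpace ρ) (ξ : Z) :
    ∃ γ : ℝ → MoebiusSpace ρ, γ 0 = a ∧
      (∀ s, 0 ≤ s → ∀ t, 0 ≤ t → dist (γ s) (γ t) ≤ |s - t|) ∧
      ∀ t, 0 ≤ t → a.1 ξ + t ≤ (γ t).1 ξ := by
  classical
  obtain ⟨p, hp1, hp2, hp3⟩ := exists_retraction_moebiusSpace hρ
  set f : ℝ → C(Z, ℝ) := fun t => ⟨fun η => a.1 η + if η = ξ then t else -t,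
    continuous_of_discreteTopology⟩
  have hf : ∀ t η, f t η = a.1 η + if η = ξ then t else -t := fun t η => rfl
  have hadm : ∀ t, 0 ≤ t → IsAdmissible ρ (f t) := by
    intro t ht η η'
    rcases eq_or_ne η η' with rfl | hne
    · rw [(hρ.1.2.2.2 η η).2 rfl]
      exact (Real.exp_pos _).le
    · refine ((a.isKernelConj hρ).le_exp η η').trans (Real.exp_le_exp.2 ?_)
      rw [hf, hf]
      split_ifs with h1 h2
      · exact absurd (h1.trans h2.symm) hne
      all_goals linarith
  refine ⟨fun t => p (f t), ?_, fun s hs t ht => ?_, fun t ht => ?_⟩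
  · have : f 0 = a.1 := by
      ext η
      simp [hf]
    change p (f 0) = a
    rw [this, hp3]
  · refine (hp2 _ _ (hadm s hs) (hadm t ht)).trans ((ContinuousMap.dist_le (abs_nonneg _)).2 ?_)
    intro η
    rw [hf, hf, Real.dist_eq]
    split_ifs
    · exact le_of_eq (by congr 1; ring)
    · exact le_of_eq (by rw [abs_sub_comm]; congr 1; ring)
  · have := hp1 _ (hadm t ht) ξ
    rwa [hf, if_pos rfl] at this

theorem isGeodesicallyComplete_moebiusSpace {Z : Type*} [TopologicalSpace Z] [CompactSpace Z]
    [DiscreteTopology Z] [Nonempty Z] {ρ : Z → Z → ℝ} (hρ : IsAntipodalFn ρ) :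
    IsGeodesicallyComplete (MoebiusSpace ρ) := by
  rintro x y γ ⟨hγ0, hγd, hγ⟩
  set d := dist x y with hd
  have hd0 : 0 ≤ d := dist_nonneg
  obtain ⟨ξ, hξ⟩ := x.exists_sub_eq_dist hρ y
  obtain ⟨η, hη⟩ := (x.isKernelConj hρ).exists_eq ξ
  obtain ⟨α, hα0, hα1, hα2⟩ := y.exists_ray hρ ξ
  obtain ⟨β, hβ0, hβ1, hβ2⟩ := x.exists_ray hρ η
  set γ' : ℝ → MoebiusSpace ρ := fun s => if s < 0 then β (-s) else if s ≤ d then γ s else α (s - d)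
  have hneg : ∀ s, s < 0 → γ' s = β (-s) := fun s hs => if_pos hs
  have hmid : ∀ s, 0 ≤ s → s ≤ d → γ' s = γ s := fun s hs hs' => by
    simp only [γ', if_neg hs.not_gt, if_pos hs']
  have hpos : ∀ s, d < s → γ' s = α (s - d) := fun s hs => by
    simp only [γ', if_neg (hd0.trans hs.le).not_gt, if_neg hs.not_ge]
  have hle : ∀ s t, s ≤ t → dist (γ' s) (γ' t) ≤ t - s := by
    have hβx : ∀ s, s < 0 → dist (β (-s)) x ≤ -s := fun s hs => by
      have := hβ1 (-s) (by linarith) 0 le_rfl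
      rwa [hβ0, sub_zero, abs_of_nonneg (by linarith)] at this
    have hαy : ∀ t, d < t → dist y (α (t - d)) ≤ t - d := fun t ht => by
      have := hα1 0 le_rfl (t - d) (by linarith)
      rwa [hα0, zero_sub, abs_neg, abs_of_nonneg (by linarith)] at this
    have hγx : ∀ t, 0 ≤ t → t ≤ d → dist x (γ t) ≤ t := fun t ht ht' => by
      have := hγ 0 ⟨le_rfl, hd0⟩ t ⟨ht, ht'⟩
      rw [hγ0, zero_sub, abs_neg, abs_of_nonneg ht] at this
      exact this.le
    have hγy : ∀ t, 0 ≤ t → t ≤ d → dist (γ t) y ≤ d - t := fun t ht ht' => by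
      have := hγ t ⟨ht, ht'⟩ d ⟨hd0, le_rfl⟩
      rw [hγd, abs_sub_comm, abs_of_nonneg (by linarith)] at this
      exact this.le
    intro s t hst
    rcases lt_or_ge s 0 with hs | hs
    · rw [hneg s hs]
      rcases lt_or_ge t 0 with ht | ht
      · rw [hneg t ht]
        have := hβ1 (-s) (by linarith) (-t) (by linarith)
        rwa [abs_of_nonneg (by linarith), show -s - -t = t - s by ring] at this
      · rcases le_or_gt t d with htd | htd
        · rw [hmid t ht htd]
          linarith [dist_triangle (β (-s)) x (γ t), hβx s hs, hγx t ht htd]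
        · rw [hpos t htd]
          linarith [dist_triangle4 (β (-s)) x y (α (t - d)), hβx s hs, hαy t htd]
    · have ht : 0 ≤ t := hs.trans hst
      rcases le_or_gt t d with htd | htd
      · rw [hmid t ht htd, hmid s hs (hst.trans htd), hγ s ⟨hs, hst.trans htd⟩ t ⟨ht, htd⟩,
          abs_sub_comm, abs_of_nonneg (by linarith)]
      · rw [hpos t htd]
        rcases le_or_gt s d with hsd | hsd
        · rw [hmid s hs hsd]
          linarith [dist_triangle (γ s) y (α (t - d)), hγy s hs hsd, hαy t htd]
        · rw [hpos s hsd]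
          have := hα1 (s - d) (by linarith) (t - d) (by linarith)
          rwa [abs_sub_comm, abs_of_nonneg (by linarith), show t - d - (s - d) = t - s by ring]
            at this
  have hx : γ' 0 = x := by rw [hmid 0 le_rfl hd0, hγ0]
  have hy : γ' d = y := by rw [hmid d hd0 le_rfl, hγd]
  have hlip : ∀ s t, s ≤ t → |(γ' s).1 ξ - (γ' t).1 ξ| ≤ t - s := fun s t h =>
    ((γ' s).abs_sub_le_dist (γ' t) ξ).trans (hle s t h)
  have hval : ∀ s, (γ' s).1 ξ = x.1 ξ + s := by
    intro s
    rcases lt_or_ge s 0 with hs | hs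
    · have h1 := abs_le.1 (hlip s 0 hs.le)
      rw [hx] at h1
      have h2 := hβ2 (-s) (by linarith)
      have h3 := ((β (-s)).isKernelConj hρ).le_exp ξ η
      rw [hη, Real.exp_le_exp] at h3
      rw [hneg s hs] at h1 ⊢
      linarith [h1.2]
    · have h1 := abs_le.1 (hlip 0 s hs)
      rw [hx] at h1
      rcases le_or_gt s d with hsd | hsd
      · have h2 := abs_le.1 (hlip s d hsd)
        rw [hy] at h2
        linarith [h1.1, h2.1]
      · have h2 := hα2 (s - d) (by linarith)
        rw [hpos s hsd] at h1 ⊢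
        linarith [h1.1]
  have heq : ∀ s t, s ≤ t → dist (γ' s) (γ' t) = |s - t| := fun s t h => by
    refine le_antisymm ((hle s t h).trans (by rw [abs_sub_comm]; exact le_abs_self _)) ?_
    have := (γ' s).abs_sub_le_dist (γ' t) ξ
    rwa [hval, hval, add_sub_add_left_eq_sub] at this
  refine ⟨γ', fun s t => ?_, fun s hs => hmid s hs.1 hs.2⟩
  rcases le_total s t with h | h
  · exact heq s t h
  · rw [dist_comm, abs_sub_comm]
    exact heq t s h

lemma MoebiusSpace.isometry_coe {Z : Type*} [TopologicalSpace Z] [Fintype Z] (ρ : Z → Z → ℝ) :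
    Isometry fun (a : MoebiusSpace ρ) (ξ : Z) => a.1 ξ := by
  refine Isometry.of_dist_eq fun a b => le_antisymm ?_ ?_
  · exact (dist_pi_le_iff dist_nonneg).2 fun ξ => a.abs_sub_le_dist b ξ
  · exact (a.dist_le_iff b dist_nonneg).2 fun ξ =>
      dist_le_pi_dist (fun ξ => a.1 ξ) (fun ξ => b.1 ξ) ξ

theorem isCompact_closedBall_moebiusSpace {Z : Type*} [TopologicalSpace Z] [Finite Z]
    [DiscreteTopology Z] {ρ : Z → Z → ℝ} (hρ : IsAntipodalFn ρ) (x : MoebiusSpace ρ) (r : ℝ) :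
    IsCompact (Metric.closedBall x r) := by
  have := Fintype.ofFinite Z
  have hiso := MoebiusSpace.isometry_coe ρ
  have hrange : Set.range (fun (a : MoebiusSpace ρ) (ξ : Z) => a.1 ξ) =
      (⋂ ξ, ⋂ η, {τ | ρ ξ η ≤ Real.exp (-(τ ξ + τ η) / 2)}) ∩
        ⋂ ξ, ⋃ η, {τ | ρ ξ η = Real.exp (-(τ ξ + τ η) / 2)} := by
    ext τ
    simp only [Set.mem_range, Set.mem_inter_iff, Set.mem_iInter, Set.mem_iUnion, Set.mem_ofPred_eq]
    constructor
    · rintro ⟨a, rfl⟩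
      exact ⟨(a.isKernelConj hρ).1, (a.isKernelConj hρ).2⟩
    · rintro ⟨h1, h2⟩
      exact ⟨⟨⟨τ, continuous_of_discreteTopology⟩, (isAntipodalFn_scaleFn_iff hρ _).2 ⟨h1, h2⟩⟩, rfl⟩
  have hclosed : IsClosed (Set.range (fun (a : MoebiusSpace ρ) (ξ : Z) => a.1 ξ)) := by
    rw [hrange]
    refine IsClosed.inter
      (isClosed_iInter fun ξ => isClosed_iInter fun η => isClosed_le (by fun_prop) (by fun_prop))
      (isClosed_iInter fun ξ => isClosed_iUnion_of_finite fun η =>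
        isClosed_eq (by fun_prop) (by fun_prop))
  have hemb : Topology.IsClosedEmbedding fun (a : MoebiusSpace ρ) (ξ : Z) => a.1 ξ :=
    ⟨hiso.isEmbedding, hclosed⟩
  rw [← hiso.preimage_closedBall]
  exact hemb.isCompact_preimage (isCompact_closedBall _ _)

lemma norm_eq_of_forall_le {ι : Type*} [Fintype ι] {f : ι → ℝ} {c : ℝ} (h0 : ∀ i, 0 ≤ f i)
    (hle : ∀ i, f i ≤ c) (heq : ∃ i, f i = c) : ‖f‖ = c := by
  obtain ⟨i, hi⟩ := heq
  refine le_antisymm ((pi_norm_le_iff_of_nonneg (hi ▸ h0 i)).2 fun j => ?_) ?_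
  · rw [Real.norm_of_nonneg (h0 j)]
    exact hle j
  · rw [← hi]
    exact (le_abs_self _).trans (norm_le_pi_norm f i)

/-- The logarithm `s ↦ -log s`, with values in `[0, ∞]` and truncated at zero. -/
noncomputable def negLog (s : ℝ) : ℝ≥0∞ := (-(ENNReal.log (ENNReal.ofReal s))).toENNReal

lemma continuous_negLog : Continuous negLog :=
  EReal.continuous_toENNReal.comp
    (continuous_neg.comp (ENNReal.continuous_log.comp ENNReal.continuous_ofReal))

lemma negLog_exp_neg (g : ℝ) : negLog (Real.exp (-g)) = ENNReal.ofReal g := by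
  rw [negLog, ENNReal.log_ofReal_of_pos (Real.exp_pos _), Real.log_exp, ← EReal.coe_neg, neg_neg]
  exact EReal.toENNReal_of_ne_top (EReal.coe_ne_top g)

lemma negLog_zero : negLog 0 = ⊤ := by
  simp [negLog]

lemma negLog_eq_top_iff {s : ℝ} (hs : 0 ≤ s) : negLog s = ⊤ ↔ s = 0 := by
  refine ⟨fun h => ?_, fun h => by rw [h, negLog_zero]⟩
  by_contra hne
  have hpos : 0 < s := lt_of_le_of_ne hs (Ne.symm hne)
  rw [← Real.exp_log hpos, ← neg_neg (Real.log s), negLog_exp_neg] at h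
  exact ENNReal.ofReal_ne_top h

open Classical in
lemma exp_neg_negLog {s : ℝ} (hs : 0 ≤ s) (hs1 : s ≤ 1) :
    (if negLog s = ⊤ then 0 else Real.exp (-(negLog s).toReal)) = s := by
  rcases hs.eq_or_lt with rfl | hpos
  · rw [if_pos negLog_zero]
  · rw [if_neg (by rw [negLog_eq_top_iff hs]; exact hpos.ne')]
    conv_lhs => rw [← Real.exp_log hpos, ← neg_neg (Real.log s), negLog_exp_neg]
    rw [ENNReal.toReal_ofReal (neg_nonneg.2 (Real.log_nonpos hs hs1)), neg_neg, Real.exp_log hpos]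

lemma single_one_nonneg {Z : Type*} [DecidableEq Z] (ξ η : Z) : (0 : ℝ) ≤ (Pi.single ξ 1 : Z → ℝ) η := by
  rw [Pi.single_apply]
  split_ifs <;> norm_num

section Compactification

variable {Z : Type u} [Fintype Z]

/-- The maximum of `N ξ * N' η * ρ ξ η` (for nonnegative functions). -/
noncomputable def pairNorm (ρ : Z → Z → ℝ) (N N' : Z → ℝ) : ℝ :=
  ‖fun p : Z × Z => N p.1 * N' p.2 * ρ p.1 p.2‖

/-- The maximum of `N ξ * exp (-x ξ / 2)` (for nonnegative functions). -/
noncomputable def weightNorm (x N : Z → ℝ) : ℝ :=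
  ‖fun ξ : Z => N ξ * Real.exp (-x ξ / 2)‖

lemma continuous_pairNorm (ρ : Z → Z → ℝ) :
    Continuous fun p : (Z → ℝ) × (Z → ℝ) => pairNorm ρ p.1 p.2 := by
  unfold pairNorm
  fun_prop

lemma continuous_weightNorm (x : Z → ℝ) : Continuous (weightNorm x) := by
  unfold weightNorm
  fun_prop

/-- The set of normalised functions `N : Z → ℝ` for which the maximum of `N ξ * N η * ρ ξ η` over
`η` does not depend on `ξ`: a compactification of the Moebius space of a finite antipodal space. -/
def moebiusCompactification (ρ : Z → Z → ℝ) : Set (Z → ℝ) :=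
  {N | (∀ ξ, 0 ≤ N ξ) ∧ ‖N‖ = 1 ∧ ∀ ξ, ∃ η, N ξ * N η * ρ ξ η = pairNorm ρ N N}

lemma isCompact_moebiusCompactification (ρ : Z → Z → ℝ) :
    IsCompact (moebiusCompactification ρ) := by
  have hc : Continuous fun N : Z → ℝ => pairNorm ρ N N :=
    (continuous_pairNorm ρ).comp (continuous_id.prodMk continuous_id)
  have heq : moebiusCompactification ρ = (⋂ ξ, {N | 0 ≤ N ξ}) ∩ ({N | ‖N‖ = 1} ∩
      ⋂ ξ, ⋃ η, {N | N ξ * N η * ρ ξ η = pairNorm ρ N N}) := by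
    ext N
    simp [moebiusCompactification]
  refine Metric.isCompact_of_isClosed_isBounded ?_ ?_
  · rw [heq]
    refine (isClosed_iInter fun ξ => isClosed_le (by fun_prop) (by fun_prop)).inter
      ((isClosed_eq (by fun_prop) (by fun_prop)).inter (isClosed_iInter fun ξ =>
        isClosed_iUnion_of_finite fun η => isClosed_eq (by fun_prop) hc))
  · refine (Metric.isBounded_closedBall (x := (0 : Z → ℝ)) (r := 1)).subset fun N hN => ?_
    rw [mem_closedBall_zero_iff]
    exact hN.2.1.le

lemma exists_eq_one {N : Z → ℝ} (h0 : ∀ ξ, 0 ≤ N ξ) (h1 : ‖N‖ = 1) : ∃ ξ, N ξ = 1 := by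
  have hne : Nonempty Z := by
    by_contra h
    rw [not_nonempty_iff] at h
    rw [Subsingleton.elim N 0, norm_zero] at h1
    exact zero_ne_one h1
  obtain ⟨ξ, hξ⟩ := Finite.exists_max N
  refine ⟨ξ, ?_⟩
  rw [← h1]
  exact (norm_eq_of_forall_le h0 hξ ⟨ξ, rfl⟩).symm

lemma apply_le_one {N : Z → ℝ} (h1 : ‖N‖ = 1) (ξ : Z) : N ξ ≤ 1 := by
  rw [← h1]
  exact (le_abs_self _).trans (norm_le_pi_norm N ξ)

lemma le_pairNorm (ρ : Z → Z → ℝ) (N N' : Z → ℝ) (ξ η : Z) :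
    N ξ * N' η * ρ ξ η ≤ pairNorm ρ N N' :=
  (le_abs_self _).trans (norm_le_pi_norm (fun p : Z × Z => N p.1 * N' p.2 * ρ p.1 p.2) (ξ, η))

lemma weightNorm_pos {N : Z → ℝ} (h0 : ∀ ξ, 0 ≤ N ξ) (h1 : ‖N‖ = 1) (x : Z → ℝ) :
    0 < weightNorm x N := by
  obtain ⟨ξ, hξ⟩ := exists_eq_one h0 h1
  have h := norm_le_pi_norm (fun ξ : Z => N ξ * Real.exp (-x ξ / 2)) ξ
  refine lt_of_lt_of_le ?_ h
  rw [hξ, one_mul]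
  exact norm_pos_iff.2 (Real.exp_ne_zero _)

variable [DecidableEq Z]

lemma pairNorm_single {ρ : Z → Z → ℝ} (hρ : ∀ ξ η, 0 ≤ ρ ξ η) (ξ η : Z) :
    pairNorm ρ (Pi.single ξ 1) (Pi.single η 1) = ρ ξ η := by
  refine norm_eq_of_forall_le ?_ ?_ ⟨(ξ, η), by simp⟩
  · rintro ⟨a, b⟩
    exact mul_nonneg (mul_nonneg (single_one_nonneg _ _) (single_one_nonneg _ _)) (hρ a b)
  · rintro ⟨a, b⟩
    rcases eq_or_ne a ξ with rfl | ha
    · rcases eq_or_ne b η with rfl | hb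
      · simp
      · simpa [Pi.single_eq_of_ne hb] using hρ _ _
    · simpa [Pi.single_eq_of_ne ha] using hρ _ _

lemma weightNorm_single (x : Z → ℝ) (ξ : Z) :
    weightNorm x (Pi.single ξ 1) = Real.exp (-x ξ / 2) := by
  refine norm_eq_of_forall_le (fun a => ?_) (fun a => ?_) ⟨ξ, by simp⟩
  · exact mul_nonneg (single_one_nonneg ξ a) (Real.exp_pos _).le
  · rcases eq_or_ne a ξ with rfl | ha
    · simp
    · simpa [Pi.single_eq_of_ne ha] using (Real.exp_pos _).le

lemma single_mem_moebiusCompactification {ρ : Z → Z → ℝ} (hρ : ∀ ξ η, 0 ≤ ρ ξ η)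
    (hρ0 : ∀ ξ, ρ ξ ξ = 0) (ξ : Z) : Pi.single ξ 1 ∈ moebiusCompactification ρ := by
  refine ⟨single_one_nonneg ξ, ?_, fun a => ⟨ξ, ?_⟩⟩
  · refine norm_eq_of_forall_le (single_one_nonneg ξ) (fun a => ?_) ⟨ξ, by simp⟩
    rw [Pi.single_apply]
    split_ifs <;> norm_num
  · rw [pairNorm_single hρ, hρ0]
    rcases eq_or_ne a ξ with rfl | ha
    · simp [hρ0]
    · simp [Pi.single_eq_of_ne ha]

lemma eq_single_of_pairNorm_eq_zero {ρ : Z → Z → ℝ} (hρ : ∀ ξ η, ξ ≠ η → 0 < ρ ξ η) {N : Z → ℝ}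
    (hN : N ∈ moebiusCompactification ρ) (h : pairNorm ρ N N = 0) : ∃ ξ, N = Pi.single ξ 1 := by
  obtain ⟨ξ, hξ⟩ := exists_eq_one hN.1 hN.2.1
  refine ⟨ξ, funext fun η => ?_⟩
  rcases eq_or_ne η ξ with rfl | hne
  · simpa using hξ
  · have h1 := le_pairNorm ρ N N ξ η
    rw [h, hξ, one_mul] at h1
    rw [Pi.single_eq_of_ne hne]
    nlinarith [hρ ξ η hne.symm, hN.1 η]

end Compactification

/-- The distance to the base point is the maximum of the logarithmic derivative. -/
lemma MoebiusSpace.le_dist_base {Z : Type*} [TopologicalSpace Z] [CompactSpace Z]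
    {ρ : Z → Z → ℝ} (hρ : IsAntipodalFn ρ) (a : MoebiusSpace ρ) (ξ : Z) :
    a.1 ξ ≤ dist a (MoebiusBase ρ hρ) := by
  have h := a.abs_sub_le_dist (MoebiusBase ρ hρ) ξ
  have h0 : (MoebiusBase ρ hρ).1 ξ = 0 := rfl
  rw [h0, sub_zero] at h
  exact (le_abs_self _).trans h

lemma MoebiusSpace.exists_eq_dist_base {Z : Type*} [TopologicalSpace Z] [CompactSpace Z]
    [Nonempty Z] {ρ : Z → Z → ℝ} (hρ : IsAntipodalFn ρ) (a : MoebiusSpace ρ) :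
    ∃ ξ, a.1 ξ = dist a (MoebiusBase ρ hρ) := by
  obtain ⟨ξ, hξ⟩ := (MoebiusBase ρ hρ).exists_sub_eq_dist hρ a
  have h0 : (MoebiusBase ρ hρ).1 ξ = 0 := rfl
  rw [h0, sub_zero, dist_comm] at hξ
  exact ⟨ξ, hξ⟩

section FiniteAntipodal

variable {Z : Type u} [Fintype Z] [TopologicalSpace Z] {ρ : Z → Z → ℝ}

/-- The function of maximum one representing a point of the Moebius space in its
compactification. -/
noncomputable def MoebiusSpace.normalize (hρ : IsAntipodalFn ρ) (a : MoebiusSpace ρ) (ξ : Z) : ℝ :=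
  Real.exp ((a.1 ξ - dist a (MoebiusBase ρ hρ)) / 2)

lemma MoebiusSpace.exists_tendsto_normalize_single [DecidableEq Z] [DiscreteTopology Z]
    (hρ : IsAntipodalFn ρ) (ξ : Z) :
    ∃ γ : ℝ → MoebiusSpace ρ,
      Tendsto (fun t => (γ t).normalize hρ) atTop (𝓝 (Pi.single ξ 1)) := by
  obtain ⟨γ, h0, h1, h2⟩ := (MoebiusBase ρ hρ).exists_ray hρ ξ
  have hb : (MoebiusBase ρ hρ).1 ξ = 0 := rfl
  have hm : ∀ t, 0 ≤ t → (γ t).1 ξ = t ∧ dist (γ t) (MoebiusBase ρ hρ) = t := fun t ht => by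
    have h3 := h1 t ht 0 le_rfl
    rw [h0, sub_zero, abs_of_nonneg ht] at h3
    have h4 := h2 t ht
    rw [hb, zero_add] at h4
    have h5 := (γ t).le_dist_base hρ ξ
    exact ⟨by linarith, by linarith⟩
  refine ⟨γ, tendsto_pi_nhds.2 fun η => ?_⟩
  rcases eq_or_ne η ξ with rfl | hne
  · rw [Pi.single_eq_same]
    refine tendsto_const_nhds.congr' ?_
    filter_upwards [eventually_ge_atTop 0] with t ht
    rw [MoebiusSpace.normalize, (hm t ht).1, (hm t ht).2, sub_self, zero_div, Real.exp_zero]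
  · rw [Pi.single_eq_of_ne hne]
    have hpos : 0 < ρ ξ η := lt_of_le_of_ne (hρ.1.2.2.1 ξ η) fun h =>
      hne.symm ((hρ.1.2.2.2 ξ η).1 h.symm)
    have hlim : Tendsto (fun t : ℝ => Real.exp (-t) / ρ ξ η) atTop (𝓝 0) := by
      simpa using Real.tendsto_exp_neg_atTop_nhds_zero.div_const (ρ ξ η)
    refine tendsto_of_tendsto_of_tendsto_of_le_of_le' tendsto_const_nhds hlim
      (Eventually.of_forall fun t => (Real.exp_pos _).le) ?_
    filter_upwards [eventually_ge_atTop 0] with t ht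
    have h3 := ((γ t).isKernelConj hρ).le_exp ξ η
    rw [le_div_iff₀ hpos, MoebiusSpace.normalize, (hm t ht).2]
    rw [(hm t ht).1] at h3
    refine (mul_le_mul_of_nonneg_left h3 (Real.exp_pos _).le).trans ?_
    rw [← Real.exp_add, Real.exp_le_exp]
    linarith

variable [Nonempty Z] (hρ : IsAntipodalFn ρ)

lemma MoebiusSpace.norm_normalize (a : MoebiusSpace ρ) : ‖a.normalize hρ‖ = 1 := by
  obtain ⟨ξ, hξ⟩ := a.exists_eq_dist_base hρ
  refine norm_eq_of_forall_le (fun ξ => (Real.exp_pos _).le) (fun ξ => ?_) ⟨ξ, ?_⟩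
  · refine Real.exp_le_one_iff.2 ?_
    linarith [a.le_dist_base hρ ξ]
  · rw [normalize, hξ, sub_self, zero_div, Real.exp_zero]

lemma MoebiusSpace.pairNorm_normalize (a b : MoebiusSpace ρ) :
    pairNorm ρ (a.normalize hρ) (b.normalize hρ) = Real.exp
      ((dist a b - dist a (MoebiusBase ρ hρ) - dist b (MoebiusBase ρ hρ)) / 2) := by
  have hform : ∀ ξ η r, a.normalize hρ ξ * b.normalize hρ η * Real.exp r = Real.exp
      ((a.1 ξ - dist a (MoebiusBase ρ hρ)) / 2 + (b.1 η - dist b (MoebiusBase ρ hρ)) / 2 + r) :=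
    fun ξ η r => by rw [Real.exp_add, Real.exp_add]; rfl
  have hnn : ∀ ξ η, 0 ≤ a.normalize hρ ξ * b.normalize hρ η := fun ξ η =>
    mul_nonneg (Real.exp_pos _).le (Real.exp_pos _).le
  obtain ⟨η, hη⟩ := a.exists_sub_eq_dist hρ b
  obtain ⟨ξ, hξ⟩ := (a.isKernelConj hρ).exists_eq η
  refine norm_eq_of_forall_le (fun p => mul_nonneg (hnn _ _) (hρ.1.2.2.1 _ _)) (fun p => ?_)
    ⟨(ξ, η), ?_⟩
  · refine (mul_le_mul_of_nonneg_left ((a.isKernelConj hρ).le_exp p.1 p.2) (hnn _ _)).trans ?_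
    rw [hform, Real.exp_le_exp]
    linarith [(abs_le.1 (a.abs_sub_le_dist b p.2)).1]
  · change a.normalize hρ ξ * b.normalize hρ η * ρ ξ η = _
    rw [hρ.symm ξ η, hξ, hform]
    congr 1
    linarith

lemma MoebiusSpace.weightNorm_normalize (a x : MoebiusSpace ρ) :
    weightNorm x.1 (a.normalize hρ) =
      Real.exp ((dist a x - dist a (MoebiusBase ρ hρ)) / 2) := by
  have hform : ∀ ξ, a.normalize hρ ξ * Real.exp (-x.1 ξ / 2) = Real.exp
      ((a.1 ξ - dist a (MoebiusBase ρ hρ)) / 2 + -x.1 ξ / 2) :=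
    fun ξ => by rw [Real.exp_add]; rfl
  obtain ⟨ξ, hξ⟩ := x.exists_sub_eq_dist hρ a
  refine norm_eq_of_forall_le
    (fun ξ => mul_nonneg (Real.exp_pos _).le (Real.exp_pos _).le) (fun ξ => ?_) ⟨ξ, ?_⟩
  · rw [hform, Real.exp_le_exp]
    linarith [(abs_le.1 (a.abs_sub_le_dist x ξ)).2]
  · rw [hform, dist_comm a x, ← hξ]
    congr 1
    ring

lemma MoebiusSpace.normalize_mem (a : MoebiusSpace ρ) :
    a.normalize hρ ∈ moebiusCompactification ρ := by
  refine ⟨fun ξ => (Real.exp_pos _).le, a.norm_normalize hρ, fun ξ => ?_⟩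
  obtain ⟨η, hη⟩ := (a.isKernelConj hρ).exists_eq ξ
  refine ⟨η, ?_⟩
  rw [a.pairNorm_normalize hρ a, hη, normalize, normalize, ← Real.exp_add, ← Real.exp_add, dist_self]
  congr 1
  ring

lemma MoebiusSpace.two_mul_log_normalize (a : MoebiusSpace ρ) (ξ : Z) :
    2 * Real.log (a.normalize hρ ξ) - Real.log (pairNorm ρ (a.normalize hρ) (a.normalize hρ)) =
      a.1 ξ := by
  rw [a.pairNorm_normalize hρ a, normalize, Real.log_exp, Real.log_exp, dist_self]
  ring

lemma MoebiusSpace.isEmbedding_normalize :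
    Topology.IsEmbedding (MoebiusSpace.normalize hρ) := by
  have hiso := MoebiusSpace.isometry_coe ρ
  have hcont : Continuous (MoebiusSpace.normalize hρ) := by
    refine continuous_pi fun ξ => ?_
    have h1 : Continuous fun a : MoebiusSpace ρ => a.1 ξ := (continuous_apply ξ).comp hiso.continuous
    unfold MoebiusSpace.normalize
    fun_prop
  set g : (Z → ℝ) → Z → ℝ := fun N ξ => 2 * Real.log (N ξ) - Real.log (pairNorm ρ N N)
  have hg : g ∘ MoebiusSpace.normalize hρ = fun a ξ => a.1 ξ :=
    funext fun a => funext fun ξ => a.two_mul_log_normalize hρ ξ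
  have hgc : ∀ a : MoebiusSpace ρ, ContinuousAt g (a.normalize hρ) := by
    intro a
    have h1 : Continuous fun N : Z → ℝ => pairNorm ρ N N :=
      (continuous_pairNorm ρ).comp (continuous_id.prodMk continuous_id)
    refine continuousAt_pi.2 fun ξ => ContinuousAt.sub (continuousAt_const.mul ?_) ?_
    · exact (continuous_apply ξ).continuousAt.log (Real.exp_ne_zero _)
    · refine h1.continuousAt.log ?_
      rw [a.pairNorm_normalize hρ a]
      exact Real.exp_ne_zero _
  refine ⟨isInducing_iff_nhds.2 fun a => le_antisymm ?_ ?_, ?_⟩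
  · exact tendsto_iff_comap.1 hcont.continuousAt
  · rw [hiso.isEmbedding.isInducing.nhds_eq_comap a, ← hg, ← comap_comap]
    refine comap_mono (tendsto_iff_comap.1 ?_)
    rw [← congrFun hg a]
    exact hgc a
  · refine Function.Injective.of_comp (f := g) ?_
    rw [hg]
    exact hiso.injective

lemma MoebiusSpace.exists_normalize_eq [DiscreteTopology Z] {N : Z → ℝ}
    (hN : N ∈ moebiusCompactification ρ) (h : 0 < pairNorm ρ N N) :
    ∃ a : MoebiusSpace ρ, a.normalize hρ = N := by
  obtain ⟨h0, h1, h2⟩ := hN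
  have hpos : ∀ ξ, 0 < N ξ := fun ξ => by
    obtain ⟨η, hη⟩ := h2 ξ
    refine lt_of_le_of_ne (h0 ξ) fun h' => ?_
    rw [← h', zero_mul, zero_mul] at hη
    exact h.ne hη
  set β := pairNorm ρ N N with hβ
  set τ : C(Z, ℝ) := ⟨fun ξ => 2 * Real.log (N ξ) - Real.log β, continuous_of_discreteTopology⟩
  have hτ : ∀ ξ, τ ξ = 2 * Real.log (N ξ) - Real.log β := fun ξ => rfl
  have hexp : ∀ ξ η, Real.exp (-(τ ξ + τ η) / 2) = β / (N ξ * N η) := fun ξ η => by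
    rw [hτ, hτ, show -(2 * Real.log (N ξ) - Real.log β + (2 * Real.log (N η) - Real.log β)) / 2 =
      Real.log β - (Real.log (N ξ) + Real.log (N η)) by ring, Real.exp_sub, Real.exp_add,
      Real.exp_log h, Real.exp_log (hpos ξ), Real.exp_log (hpos η)]
  have hK : IsKernelConj ρ τ τ := by
    refine ⟨fun ξ η => ?_, fun ξ => (h2 ξ).imp fun η hη => ?_⟩
    · rw [hexp, le_div_iff₀ (mul_pos (hpos ξ) (hpos η)), mul_comm]
      exact le_pairNorm ρ N N ξ η
    · rw [hexp, eq_div_iff (mul_pos (hpos ξ) (hpos η)).ne', mul_comm, hη]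
  set a : MoebiusSpace ρ := ⟨τ, (isAntipodalFn_scaleFn_iff hρ τ).2 hK⟩
  have ha : ∀ ξ, a.1 ξ = 2 * Real.log (N ξ) - Real.log β := hτ
  have hm : dist a (MoebiusBase ρ hρ) = -Real.log β := by
    obtain ⟨ξ, hξ⟩ := exists_eq_one h0 h1
    obtain ⟨η, hη⟩ := a.exists_eq_dist_base hρ
    refine le_antisymm ?_ ?_
    · rw [← hη, ha]
      linarith [Real.log_nonpos (h0 η) (apply_le_one h1 η)]
    · have h3 := a.le_dist_base hρ ξ
      rwa [ha, hξ, Real.log_one, mul_zero, zero_sub] at h3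
  refine ⟨a, funext fun ξ => ?_⟩
  rw [MoebiusSpace.normalize, hm, ha, show (2 * Real.log (N ξ) - Real.log β - -Real.log β) / 2 =
    Real.log (N ξ) by ring, Real.exp_log (hpos ξ)]

end FiniteAntipodal

lemma scaleFn_sq {Z : Type*} (ρ : Z → Z → ℝ) (τ : Z → ℝ) (ξ η : Z) :
    scaleFn ρ τ ξ η ^ 2 = Real.exp (τ ξ) * Real.exp (τ η) * ρ ξ η ^ 2 := by
  simp only [scaleFn, mul_pow, ← Real.exp_nat_mul]
  push_cast
  rw [mul_div_cancel₀ _ two_ne_zero, mul_div_cancel₀ _ two_ne_zero]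

lemma scaleFn_add {Z : Type*} (ρ : Z → Z → ℝ) (σ τ : Z → ℝ) :
    scaleFn ρ (fun ζ => σ ζ + τ ζ) = scaleFn (scaleFn ρ σ) τ := by
  funext ξ η
  simp only [scaleFn, add_div, Real.exp_add]
  ring

/-- The Moebius space of a finite antipodal space is a maximal Gromov product space with that
space as its boundary. -/
theorem exists_gromovProductData_moebiusSpace {Z : Type u} [TopologicalSpace Z] [Finite Z]
    [DiscreteTopology Z] [Nonempty Z] {ρ : Z → Z → ℝ} (hρ : IsAntipodalFn ρ) :
    ∃ D : GromovProductData (MoebiusSpace ρ), D.IsMaximal ∧ Finite D.Boundary := by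
  classical
  have := Fintype.ofFinite Z
  have hnn : ∀ ξ η, 0 ≤ ρ ξ η := hρ.1.2.2.1
  have hdiag : ∀ ξ, ρ ξ ξ = 0 := fun ξ => (hρ.1.2.2.2 ξ ξ).2 rfl
  have hpos : ∀ ξ η, ξ ≠ η → 0 < ρ ξ η := fun ξ η h =>
    lt_of_le_of_ne (hnn ξ η) fun h' => h ((hρ.1.2.2.2 ξ η).1 h'.symm)
  set bI : Z → moebiusCompactification ρ := fun ξ =>
    ⟨Pi.single ξ 1, single_mem_moebiusCompactification hnn hdiag ξ⟩ with hbI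
  have hbI_inj : Function.Injective bI := fun ξ η h => by
    by_contra hne
    have h1 := congrFun (Subtype.ext_iff.1 h) ξ
    simp [hbI, Pi.single_eq_of_ne hne] at h1
  set I : MoebiusSpace ρ → moebiusCompactification ρ := fun a =>
    ⟨a.normalize hρ, a.normalize_mem hρ⟩ with hI
  set Q : MoebiusSpace ρ → moebiusCompactification ρ → moebiusCompactification ρ → ℝ :=
    fun x p q => pairNorm ρ p.1 q.1 / (weightNorm x.1 p.1 * weightNorm x.1 q.1) with hQ
  have hw : ∀ (x : MoebiusSpace ρ) (p : moebiusCompactification ρ), 0 < weightNorm x.1 p.1 :=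
    fun x p => weightNorm_pos p.2.1 p.2.2.1 x.1
  have hQc : ∀ x, Continuous fun pq : moebiusCompactification ρ × moebiusCompactification ρ =>
      Q x pq.1 pq.2 := fun x => by
    refine Continuous.div ?_ ?_ fun pq => (mul_pos (hw x pq.1) (hw x pq.2)).ne'
    · exact (continuous_pairNorm ρ).comp
        ((continuous_subtype_val.comp continuous_fst).prodMk
          (continuous_subtype_val.comp continuous_snd))
    · exact ((continuous_weightNorm x.1).comp (continuous_subtype_val.comp continuous_fst)).mul
        ((continuous_weightNorm x.1).comp (continuous_subtype_val.comp continuous_snd))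
  have hQI : ∀ x y z, Q x (I y) (I z) =
      Real.exp (-((dist y x + dist z x - dist y z) / 2)) := fun x y z => by
    simp only [hQ, hI]
    rw [y.pairNorm_normalize hρ z, y.weightNorm_normalize hρ x, z.weightNorm_normalize hρ x,
      ← Real.exp_add, ← Real.exp_sub]
    congr 1
    ring
  have hQb : ∀ x ξ η, Q x (bI ξ) (bI η) = scaleFn ρ x.1 ξ η := fun x ξ η => by
    simp only [hQ, hbI]
    rw [pairNorm_single hnn, weightNorm_single, weightNorm_single, scaleFn_eq, ← Real.exp_add]
    congr 2
    ring
  have hdense : Dense (Set.range I) := by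
    rintro ⟨N, hN⟩
    rcases (norm_nonneg _ : 0 ≤ pairNorm ρ N N).eq_or_lt with h | h
    · obtain ⟨ξ, rfl⟩ := eq_single_of_pairNorm_eq_zero hpos hN h.symm
      obtain ⟨γ, hγ⟩ := MoebiusSpace.exists_tendsto_normalize_single hρ ξ
      refine mem_closure_of_tendsto (f := fun t => I (γ t)) (b := atTop)
        (tendsto_subtype_rng.2 hγ) (Eventually.of_forall fun t => ⟨_, rfl⟩)
    · obtain ⟨a, rfl⟩ := MoebiusSpace.exists_normalize_eq hρ hN h
      exact subset_closure ⟨a, rfl⟩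
  have hrange : Set.range bI = (Set.range I)ᶜ := by
    ext ⟨N, hN⟩
    constructor
    · rintro ⟨ξ, hξ⟩ ⟨a, ha⟩
      have h1 : Pi.single ξ 1 = a.normalize hρ := Subtype.ext_iff.1 (hξ.trans ha.symm)
      have h2 := a.pairNorm_normalize hρ a
      rw [← h1, pairNorm_single hnn, hdiag] at h2
      exact (Real.exp_pos _).ne h2
    · intro h
      rcases (norm_nonneg _ : 0 ≤ pairNorm ρ N N).eq_or_lt with h1 | h1
      · obtain ⟨ξ, rfl⟩ := eq_single_of_pairNorm_eq_zero hpos hN h1.symm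
        exact ⟨ξ, rfl⟩
      · obtain ⟨a, rfl⟩ := MoebiusSpace.exists_normalize_eq hρ hN h1
        exact absurd ⟨a, rfl⟩ h
  have hcompact : CompactSpace (moebiusCompactification ρ) :=
    isCompact_iff_compactSpace.1 (isCompact_moebiusCompactification ρ)
  let D : GromovProductData (MoebiusSpace ρ) :=
    { geodesic := isGeodesicSpace_moebiusSpace hρ
      geodesicallyComplete := isGeodesicallyComplete_moebiusSpace hρ
      proper := isCompact_closedBall_moebiusSpace hρ
      Compactification := moebiusCompactification ρ
      compactC := hcompact
      t2C := inferInstance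
      secondCountableC := inferInstance
      incl := I
      isEmbedding_incl := (MoebiusSpace.isEmbedding_normalize hρ).codRestrict _ _
      dense_incl := hdense
      Boundary := Z
      bIncl := bI
      isEmbedding_bIncl :=
        (continuous_of_discreteTopology.isClosedEmbedding hbI_inj).isEmbedding
      range_bIncl := hrange
      gp := fun x p q => negLog (Q x p q)
      continuous_gp := fun x => continuous_negLog.comp (hQc x)
      gp_eq := fun x y z => by rw [hQI, negLog_exp_neg]
      gp_top_iff := fun x ξ η => by
        rw [hQb, negLog_eq_top_iff (x.2.1.2.2.1 ξ η), x.2.1.2.2.2 ξ η] }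
  have hvis : ∀ x : MoebiusSpace ρ, D.visual x = scaleFn ρ x.1 := fun x => by
    funext ξ η
    change (if negLog (Q x (bI ξ) (bI η)) = ⊤ then 0
      else Real.exp (-(negLog (Q x (bI ξ) (bI η))).toReal)) = _
    rw [hQb]
    exact exp_neg_negLog (x.2.1.2.2.1 ξ η) (x.2.2.1 ξ η)
  have hsq : ∀ (τ σ : Z → ℝ) (ξ η : Z), scaleFn ρ (fun ζ => σ ζ + τ ζ) ξ η ^ 2 =
      Real.exp (τ ξ) * Real.exp (τ η) * scaleFn ρ σ ξ η ^ 2 := fun τ σ ξ η => by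
    rw [scaleFn_add, scaleFn_sq]
  refine ⟨D, fun x => ⟨fun y z => ⟨fun ξ => z.1 ξ - y.1 ξ, fun ξ η => ?_, ?_⟩, ?_⟩, ‹Finite Z›⟩
  · rw [hvis, hvis]
    refine Eq.trans ?_ (hsq (fun ζ => z.1 ζ - y.1 ζ) y.1 ξ η)
    congr 2
    funext ζ
    ring
  · refine ⟨?_, fun r hr => ?_⟩
    · rintro _ ⟨ξ, rfl⟩
      change |z.1 ξ - y.1 ξ| ≤ dist y z
      rw [abs_sub_comm]
      exact y.abs_sub_le_dist z ξ
    · obtain ⟨ξ, hξ⟩ := y.exists_sub_eq_dist hρ z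
      rw [← hξ]
      exact (le_abs_self _).trans (hr ⟨ξ, rfl⟩)
  · rintro β hβ ⟨τ, hτc, hτ⟩
    have hβeq : scaleFn ρ (fun ζ => x.1 ζ + τ ζ) = β := by
      funext ξ η
      refine (sq_eq_sq₀ ?_ (hβ.1.2.2.1 ξ η)).1 ?_
      · exact mul_nonneg (mul_nonneg (Real.exp_pos _).le (Real.exp_pos _).le) (hnn _ _)
      · rw [hsq, hτ, hvis]
    refine ⟨⟨⟨fun ζ => x.1 ζ + τ ζ, continuous_of_discreteTopology⟩, ?_⟩, ?_⟩
    · exact hβeq ▸ hβ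
    · exact (hvis _).trans hβeq

open Classical in
lemma continuous_ite_exp_neg_toReal :
    Continuous fun t : ℝ≥0∞ => if t = ⊤ then (0 : ℝ) else Real.exp (-t.toReal) := by
  have hc : Continuous fun t : ℝ≥0∞ => EReal.exp (-(t : EReal)) :=
    ENNReal.continuous_exp.comp (continuous_neg.comp continuous_coe_ennreal_ereal)
  have hne : ∀ t : ℝ≥0∞, EReal.exp (-(t : EReal)) ≠ ⊤ := fun t => by
    rw [Ne, EReal.exp_eq_top_iff, EReal.neg_eq_top_iff]
    exact EReal.coe_ennreal_ne_bot t
  refine (ENNReal.continuousOn_toReal.comp_continuous hc hne).congr fun t => ?_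
  split_ifs with h
  · simp [h]
  · change (EReal.exp (-(t : EReal))).toReal = _
    rw [← EReal.coe_toReal (x := (t : EReal)) (by simpa using h) (EReal.coe_ennreal_ne_bot t),
      ← EReal.coe_neg, EReal.exp_coe, ENNReal.toReal_ofReal (Real.exp_pos _).le,
      EReal.toReal_coe_ennreal]

section GromovProduct

variable {X : Type u} [MetricSpace X] (D : GromovProductData X)

lemma GromovProductData.isOpen_range_incl : IsOpen (Set.range D.incl) := by
  have := D.t2C
  rw [isOpen_iff_mem_nhds]
  rintro _ ⟨x, rfl⟩
  obtain ⟨U, hU, hUx⟩ := D.isEmbedding_incl.isInducing.isOpen_iff.1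
    (Metric.isOpen_ball (x := x) (ε := 1))
  have hxU : D.incl x ∈ U := by
    have : x ∈ D.incl ⁻¹' U := hUx ▸ Metric.mem_ball_self one_pos
    exact this
  refine mem_of_superset (hU.mem_nhds hxU) ((D.dense_incl.open_subset_closure_inter hU).trans ?_)
  have hcl : IsClosed (D.incl '' Metric.closedBall x 1) :=
    ((D.proper x 1).image D.isEmbedding_incl.continuous).isClosed
  refine (closure_minimal ?_ hcl).trans (Set.image_subset_range _ _)
  rintro _ ⟨hy, y, rfl⟩
  have hy' : y ∈ D.incl ⁻¹' U := hy
  rw [hUx] at hy'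
  exact ⟨y, Metric.ball_subset_closedBall hy', rfl⟩

lemma GromovProductData.compactSpace_boundary : CompactSpace D.Boundary := by
  have := D.compactC
  have hcl : IsClosed (Set.range D.bIncl) := by
    rw [D.range_bIncl]
    exact D.isOpen_range_incl.isClosed_compl
  exact (Topology.IsClosedEmbedding.mk D.isEmbedding_bIncl hcl).compactSpace

lemma GromovProductData.t2Space_boundary : T2Space D.Boundary :=
  have := D.t2C
  D.isEmbedding_bIncl.t2Space

lemma GromovProductData.gp_symm (x : X) (p q : D.Compactification) :
    D.gp x p q = D.gp x q p := by
  have hd : DenseRange (Prod.map D.incl D.incl) := DenseRange.prodMap D.dense_incl D.dense_incl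
  have heq := hd.equalizer (D.continuous_gp x) ((D.continuous_gp x).comp continuous_swap) <| by
    funext ⟨y, z⟩
    change D.gp x (D.incl y) (D.incl z) = D.gp x (D.incl z) (D.incl y)
    rw [D.gp_eq, D.gp_eq, dist_comm y z, add_comm (dist y x)]
  exact congrFun heq (p, q)

lemma GromovProductData.exists_gp_eq_zero (x : X) (ξ : D.Boundary) :
    ∃ η : D.Boundary, D.gp x (D.bIncl ξ) (D.bIncl η) = 0 := by
  have := D.t2C
  have := D.compactC
  have := D.secondCountableC
  obtain ⟨u, hu, hlim⟩ := mem_closure_iff_seq_limit.1 (D.dense_incl (D.bIncl ξ))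
  choose y hy using hu
  have hray : ∀ n : ℕ, ∃ z : X, dist z x = n ∧ dist (y n) z = dist (y n) x + dist z x := by
    intro n
    obtain ⟨γ, hγ⟩ := D.geodesic x (y n)
    obtain ⟨γ', h1, h2⟩ := D.geodesicallyComplete x (y n) γ hγ
    have h3 : γ' 0 = x := (h2 0 ⟨le_rfl, dist_nonneg⟩).trans hγ.1
    have h4 : γ' (dist x (y n)) = y n := (h2 _ ⟨dist_nonneg, le_rfl⟩).trans hγ.2.1
    have h5 : dist (γ' (-n)) x = n := by
      conv_lhs => rw [← h3]
      rw [h1, sub_zero, abs_neg, abs_of_nonneg n.cast_nonneg]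
    refine ⟨γ' (-n), h5, ?_⟩
    rw [h5, dist_comm (y n) x]
    conv_lhs => rw [← h4]
    have h6 : (0 : ℝ) ≤ dist x (y n) + n := by positivity
    rw [h1, sub_neg_eq_add, abs_of_nonneg h6]
  choose z hz hyz using hray
  obtain ⟨p, φ, hφ, hp⟩ := CompactSpace.tendsto_subseq fun n => D.incl (z n)
  have hpB : p ∈ Set.range D.bIncl := by
    rw [D.range_bIncl]
    rintro ⟨w, rfl⟩
    have h1 : Tendsto (z ∘ φ) atTop (𝓝 w) := D.isEmbedding_incl.tendsto_nhds_iff.2 hp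
    have h2 : Tendsto (fun n => dist ((z ∘ φ) n) x) atTop (𝓝 (dist w x)) :=
      h1.dist tendsto_const_nhds
    simp only [Function.comp_apply, hz] at h2
    exact not_tendsto_nhds_of_tendsto_atTop
      (tendsto_natCast_atTop_atTop.comp hφ.tendsto_atTop) _ h2
  obtain ⟨η, rfl⟩ := hpB
  refine ⟨η, tendsto_nhds_unique (((D.continuous_gp x).tendsto (D.bIncl ξ, D.bIncl η)).comp
    ((hlim.comp hφ.tendsto_atTop).prodMk_nhds hp)) (tendsto_const_nhds.congr fun n => ?_)⟩
  simp only [Function.comp_apply, ← hy]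
  rw [D.gp_eq, hyz, sub_self, zero_div, ENNReal.ofReal_zero]

lemma GromovProductData.isAntipodalFn_visual (x : X) : IsAntipodalFn (D.visual x) := by
  refine ⟨⟨?_, fun ξ η => ?_, fun ξ η => ?_, fun ξ η => ?_⟩, fun ξ η => ?_, fun ξ => ?_⟩
  · exact continuous_ite_exp_neg_toReal.comp ((D.continuous_gp x).comp
      (D.isEmbedding_bIncl.continuous.prodMap D.isEmbedding_bIncl.continuous))
  · simp only [visual, D.gp_symm x (D.bIncl ξ) (D.bIncl η)]
  · simp only [visual]
    split_ifs
    exacts [le_rfl, (Real.exp_pos _).le]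
  · rw [← D.gp_top_iff x, visual]
    split_ifs with h
    · simp [h]
    · simp [h, Real.exp_ne_zero]
  · simp only [visual]
    split_ifs
    · exact zero_le_one
    · simp
  · obtain ⟨η, hη⟩ := D.exists_gp_eq_zero x ξ
    exact ⟨η, by simp [visual, hη]⟩

end GromovProduct

/-- The factors of a Moebius equivalence are unique on a space with at least three points. -/
lemma eq_of_forall_exp_mul_eq {Z : Type*} [Infinite Z] {τ σ : Z → ℝ}
    (h : ∀ ξ η, ξ ≠ η → Real.exp (τ ξ) * Real.exp (τ η) = Real.exp (σ ξ) * Real.exp (σ η)) :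
    τ = σ := by
  classical
  have h' : ∀ ξ η, ξ ≠ η → τ ξ + τ η = σ ξ + σ η := fun ξ η hne => by
    have := h ξ η hne
    rwa [← Real.exp_add, ← Real.exp_add, Real.exp_eq_exp] at this
  funext ξ
  obtain ⟨η, hη⟩ := Infinite.exists_notMem_finset {ξ}
  obtain ⟨ζ, hζ⟩ := Infinite.exists_notMem_finset {ξ, η}
  simp only [Finset.mem_singleton, Finset.mem_insert, not_or] at hη hζ
  linarith [h' ξ η (Ne.symm hη), h' ξ ζ (Ne.symm hζ.1), h' η ζ (Ne.symm hζ.2)]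

lemma IsAntipodalFn.eq_of_forall_sq_eq {Z : Type*} [TopologicalSpace Z] [Infinite Z]
    {ρ : Z → Z → ℝ} (hρ : IsAntipodalFn ρ) {τ σ : Z → ℝ}
    (h : ∀ ξ η, Real.exp (τ ξ) * Real.exp (τ η) * ρ ξ η ^ 2 =
      Real.exp (σ ξ) * Real.exp (σ η) * ρ ξ η ^ 2) : τ = σ :=
  eq_of_forall_exp_mul_eq fun ξ η hne => mul_right_cancel₀
    (pow_ne_zero 2 fun h0 => hne ((hρ.1.2.2.2 ξ η).1 h0)) (h ξ η)

/-- The logarithmic derivative of a Moebius equivalence is continuous. -/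
lemma IsAntipodalFn.continuous_of_forall_sq_eq {Z : Type*} [TopologicalSpace Z]
    {ρ β : Z → Z → ℝ} (hρ : IsAntipodalFn ρ) (hβ : IsAntipodalFn β) {τ : Z → ℝ}
    (h : ∀ ξ η, β ξ η ^ 2 = Real.exp (τ ξ) * Real.exp (τ η) * ρ ξ η ^ 2) : Continuous τ := by
  refine continuous_iff_continuousAt.2 fun ξ => ?_
  obtain ⟨η, hη⟩ := hβ.2.2 ξ
  have hne : ρ ξ η ≠ 0 := fun h0 => by
    have := h ξ η
    rw [hη, h0] at this
    norm_num at this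
  have hβc : Continuous fun ζ => β ζ η := hβ.1.1.comp (continuous_id.prodMk continuous_const)
  have hρc : Continuous fun ζ => ρ ζ η := hρ.1.1.comp (continuous_id.prodMk continuous_const)
  have hc : ContinuousAt (fun ζ => Real.log (β ζ η ^ 2) - Real.log (ρ ζ η ^ 2) - τ η) ξ :=
    (((hβc.pow 2).continuousAt.log (pow_ne_zero 2 (hη.trans_ne one_ne_zero))).sub
      ((hρc.pow 2).continuousAt.log (pow_ne_zero 2 hne))).sub continuousAt_const
  refine hc.congr ?_
  filter_upwards [hρc.continuousAt.eventually_ne hne] with ζ hζ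
  rw [h ζ η, Real.log_mul (by positivity) (pow_ne_zero 2 hζ), ← Real.exp_add, Real.log_exp]
  ring

lemma scaleFn_eq_of_forall_sq_eq {Z : Type*} {ρ β : Z → Z → ℝ} {τ : Z → ℝ}
    (hρ : ∀ ξ η, 0 ≤ ρ ξ η) (hβ : ∀ ξ η, 0 ≤ β ξ η)
    (h : ∀ ξ η, β ξ η ^ 2 = Real.exp (τ ξ) * Real.exp (τ η) * ρ ξ η ^ 2) : scaleFn ρ τ = β := by
  funext ξ η
  refine (sq_eq_sq₀ ?_ (hβ ξ η)).1 (by rw [scaleFn_sq, h])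
  exact mul_nonneg (mul_nonneg (Real.exp_pos _).le (Real.exp_pos _).le) (hρ ξ η)

theorem GromovProductData.IsMaximal.exists_isometryEquiv {X : Type u} [MetricSpace X]
    {D : GromovProductData X} (hD : D.IsMaximal) [CompactSpace D.Boundary] [Infinite D.Boundary]
    (x : X) : ∃ e : MoebiusSpace (D.visual x) ≃ᵢ X,
      e (MoebiusBase (D.visual x) (D.isAntipodalFn_visual x)) = x := by
  have hA := D.isAntipodalFn_visual
  choose τ hτ hτd using fun y z => (hD x).1 y z
  have hτx : ∀ y, scaleFn (D.visual x) (τ x y) = D.visual y := fun y =>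
    scaleFn_eq_of_forall_sq_eq (hA x).1.2.2.1 (hA y).1.2.2.1 (hτ x y)
  have hφ : ∀ y, ∃ b : MoebiusSpace (D.visual x), ∀ ξ, b.1 ξ = τ x y ξ := fun y =>
    ⟨⟨⟨τ x y, (hA x).continuous_of_forall_sq_eq (hA y) (hτ x y)⟩, (hτx y).symm ▸ hA y⟩,
      fun ξ => rfl⟩
  choose φ hφ using hφ
  have hsub : ∀ y z ξ, τ y z ξ = τ x z ξ - τ x y ξ := fun y z => by
    refine congrFun ((hA y).eq_of_forall_sq_eq (σ := fun ξ => τ x z ξ - τ x y ξ) fun ξ η => ?_)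
    rw [← hτ, hτ x z, hτ x y, Real.exp_sub, Real.exp_sub]
    have h1 := Real.exp_ne_zero (τ x y ξ)
    have h2 := Real.exp_ne_zero (τ x y η)
    field_simp
  have hiso : Isometry φ := Isometry.of_dist_eq fun y z => by
    refine le_antisymm ?_ ?_
    · refine ((φ y).dist_le_iff (φ z) dist_nonneg).2 fun ξ => ?_
      rw [hφ, hφ, abs_sub_comm, ← hsub y z]
      exact (hτd y z).1 ⟨ξ, rfl⟩
    · refine (hτd y z).2 ?_
      rintro _ ⟨ξ, rfl⟩
      change |τ y z ξ| ≤ _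
      rw [hsub, ← hφ, ← hφ, abs_sub_comm]
      exact (φ y).abs_sub_le_dist (φ z) ξ
  have hsurj : Function.Surjective φ := fun b => by
    obtain ⟨y, hy⟩ := (hD x).2 (scaleFn (D.visual x) b.1) b.2
      ⟨b.1, b.1.continuous, fun ξ η => scaleFn_sq _ _ ξ η⟩
    refine ⟨y, Subtype.ext (ContinuousMap.ext fun ξ => ?_)⟩
    refine (hφ y ξ).trans (congrFun ((hA x).eq_of_forall_sq_eq fun ξ η => ?_) ξ)
    rw [← hτ, hy, scaleFn_sq]
  have hbase : φ x = MoebiusBase (D.visual x) (hA x) := by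
    refine Subtype.ext (ContinuousMap.ext fun ξ => (hφ x ξ).trans ?_)
    exact (hsub x x ξ).trans (sub_self _)
  set e := (IsometryEquiv.mk' φ (Function.surjInv hsurj) (Function.surjInv_eq hsurj) hiso).symm
  exact ⟨e, by rw [← hbase]; exact e.apply_symm_apply x⟩

lemma PointedGHConverges.comp_isometryEquiv {X : ℕ → Type u} [∀ n, MetricSpace (X n)]
    {p : ∀ n, X n} {Y W : Type v} [MetricSpace Y] [MetricSpace W] {q : Y}
    (h : PointedGHConverges X p Y q) (e : Y ≃ᵢ W) : PointedGHConverges X p W (e q) := by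
  intro R hR ε hε
  obtain ⟨N, hN⟩ := h R hR ε hε
  refine ⟨N, fun n hn => ?_⟩
  obtain ⟨f, h1, h2, h3⟩ := hN n hn
  refine ⟨fun a => ⟨e (f a), ?_⟩, ?_, fun a b => ?_, ?_⟩
  · rw [Metric.mem_closedBall, e.dist_eq]
    exact (f a).2
  · exact congrArg e h1
  · rw [e.dist_eq]
    exact h2 a b
  · rintro ⟨z, hz⟩
    obtain ⟨z, rfl⟩ := e.surjective z
    rw [Metric.mem_closedBall, e.dist_eq] at hz
    obtain ⟨a, ha⟩ := h3 ⟨z, hz⟩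
    exact ⟨a, by rwa [e.dist_eq]⟩

lemma pointedGHConverges_const {X : Type u} [MetricSpace X] (x : X) :
    PointedGHConverges (fun _ => X) (fun _ => x) X x := fun R hR ε hε =>
  ⟨0, fun _ _ => ⟨id, rfl, fun a b => by simpa using hε, fun z => ⟨z, by simpa using hε⟩⟩⟩

lemma IsAntipodalFn.exists_finite_net {Z : Type*} [TopologicalSpace Z] [CompactSpace Z]
    {ρ : Z → Z → ℝ} (hρ : IsAntipodalFn ρ) {ε : ℝ} (hε : 0 < ε) : ∃ S : Set Z, S.Finite ∧
      (∀ ξ, ∃ ζ ∈ S, ρ ξ ζ < ε) ∧ ∀ ξ ∈ S, ∃ η ∈ S, ρ ξ η = 1 := by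
  have hc : ∀ ζ, Continuous fun ξ => ρ ξ ζ := fun ζ =>
    hρ.1.1.comp (continuous_id.prodMk continuous_const)
  obtain ⟨t, -, ht⟩ := isCompact_univ.elim_nhds_subcover (fun ζ => {ξ | ρ ξ ζ < ε})
    fun ζ _ => ((hc ζ).isOpen_preimage _ isOpen_Iio).mem_nhds <| by
      change ρ ζ ζ < ε
      rwa [(hρ.1.2.2.2 ζ ζ).2 rfl]
  choose α hα using hρ.2.2
  refine ⟨t ∪ α '' t, t.finite_toSet.union (t.finite_toSet.image α), fun ξ => ?_, ?_⟩
  · obtain ⟨ζ, hζ, hξ⟩ := Set.mem_iUnion₂.1 (ht (Set.mem_univ ξ))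
    exact ⟨ζ, Or.inl hζ, hξ⟩
  · rintro ξ (hξ | ⟨ζ, hζ, rfl⟩)
    · exact ⟨α ξ, Or.inr ⟨ξ, hξ, rfl⟩, hα ξ⟩
    · exact ⟨ζ, Or.inl hζ, by rw [hρ.symm, hα]⟩

lemma IsAntipodalFn.restrict {Z : Type*} [TopologicalSpace Z] {ρ : Z → Z → ℝ}
    (hρ : IsAntipodalFn ρ) {S : Set Z} (hS : ∀ ξ ∈ S, ∃ η ∈ S, ρ ξ η = 1) :
    IsAntipodalFn fun ξ η : S => ρ ξ η := by
  refine ⟨⟨?_, fun ξ η => hρ.symm ξ η, fun ξ η => hρ.1.2.2.1 ξ η, fun ξ η => ?_⟩,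
    fun ξ η => hρ.2.1 ξ η, fun ξ => ?_⟩
  · exact hρ.1.1.comp (continuous_subtype_val.prodMap continuous_subtype_val)
  · rw [hρ.1.2.2.2, Subtype.ext_iff]
  · obtain ⟨η, hη, h⟩ := hS ξ ξ.2
    exact ⟨⟨η, hη⟩, h⟩

theorem GromovProductData.IsMaximal.exists_pointedGHConverges {X : Type u} [MetricSpace X]
    {D : GromovProductData X} (hD : D.IsMaximal) (x : X) :
    ∃ (X' : ℕ → Type u) (iX' : ∀ n, MetricSpace (X' n))
      (D' : ∀ n, @GromovProductData (X' n) (iX' n)) (p : ∀ n, X' n),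
      (∀ n, (D' n).IsMaximal) ∧ (∀ n, Finite (D' n).Boundary) ∧ PointedGHConverges X' p X x := by
  rcases finite_or_infinite D.Boundary with hfin | hinf
  · exact ⟨fun _ => X, fun _ => inferInstance, fun _ => D, fun _ => x, fun _ => hD, fun _ => hfin,
      pointedGHConverges_const x⟩
  · have := D.compactSpace_boundary
    have := D.t2Space_boundary
    have hA := D.isAntipodalFn_visual x
    choose S hfin hnet hanti using fun n : ℕ => hA.exists_finite_net (Nat.one_div_pos_of_nat (n := n))
    have hS : ∀ n, Finite (S n) := hfin
    have hSne : ∀ n, Nonempty (S n) := fun n => by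
      obtain ⟨ζ, hζ, -⟩ := hnet n (Classical.arbitrary D.Boundary)
      exact ⟨⟨ζ, hζ⟩⟩
    have hSA := fun n => hA.restrict (hanti n)
    choose D' hmax hbdry using fun n => exists_gromovProductData_moebiusSpace (hSA n)
    obtain ⟨e, he⟩ := hD.exists_isometryEquiv x
    have hconv := (pointedGHConverges_moebiusSpace hA hnet hSA).comp_isometryEquiv e
    rw [he] at hconv
    exact ⟨_, fun n => inferInstance, D', _, hmax, hbdry, hconv⟩

/-- Let `(Z, ρ₀)` be an antipodal space and, for each `n`, let `Zn n ⊆ Z` be a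
finite `1/(n+1)`-net of `Z` such that every point of `Zn n` has a `ρ₀`-antipode in `Zn n`; let
`ρ n` be the restriction of `ρ₀`, a finite antipodal space. Then `(Zn n, ρ n)` AI-converges to
`(Z, ρ₀)`, the pointed Moebius spaces `(𝓜(Zn n, ρ n), ρ n)` converge to `(𝓜(Z, ρ₀), ρ₀)` in
the pointed Gromov–Hausdorff sense and, in particular, every maximal Gromov product space is a
pointed Gromov–Hausdorff limit of maximal Gromov product (hyperbolic) spaces with finite
boundary. -/
theorem moebius_space_GH_limit_of_finite_approximations
    {Z : Type u} [TopologicalSpace Z] [CompactSpace Z] [TopologicalSpace.MetrizableSpace Z]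
    (ρ₀ : Z → Z → ℝ) (hρ₀ : IsAntipodalFn ρ₀)
    (Zn : ℕ → Set Z) [∀ n, Finite (Zn n)]
    (hnet : ∀ (n : ℕ) (ξ : Z), ∃ ζ ∈ Zn n, ρ₀ ξ ζ < 1 / (n + 1))
    (hanti : ∀ n, ∀ ξ ∈ Zn n, ∃ η ∈ Zn n, ρ₀ ξ η = 1)
    (hρn : ∀ n, IsAntipodalFn (fun ξ η : Zn n => ρ₀ ξ η)) :
    AIConverges (fun n => fun ξ η : Zn n => ρ₀ ξ η) ρ₀ ∧
    PointedGHConverges (fun n => MoebiusSpace (fun ξ η : Zn n => ρ₀ ξ η))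
      (fun n => MoebiusBase _ (hρn n)) (MoebiusSpace ρ₀) (MoebiusBase ρ₀ hρ₀) ∧
    (∀ (X : Type u) (iX : MetricSpace X) (D : @GromovProductData X iX),
      D.IsMaximal → ∀ x : X,
        ∃ (X' : ℕ → Type u) (iX' : ∀ n, MetricSpace (X' n))
          (D' : ∀ n, @GromovProductData (X' n) (iX' n)) (p : ∀ n, X' n),
          (∀ n, (D' n).IsMaximal) ∧ (∀ n, Finite (D' n).Boundary) ∧
          @PointedGHConverges X' iX' p X iX x) := by
  refine ⟨⟨fun n => 1 / (n + 1), fun n => Nat.one_div_pos_of_nat,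
    tendsto_one_div_add_atTop_nhds_zero_nat, fun n => ⟨Subtype.val, fun ξ η => ?_, fun ζ => ?_⟩⟩,
    pointedGHConverges_moebiusSpace hρ₀ hnet hρn,
    fun X iX D hD x => hD.exists_pointedGHConverges x⟩
  · rw [sub_self, abs_zero]
    exact Nat.one_div_pos_of_nat
  · obtain ⟨ξ, hξ, h⟩ := hnet n ζ
    exact ⟨⟨ξ, hξ⟩, by rwa [hρ₀.symm]⟩
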